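/- arXiv:2412.03852 — 2 statements merged into one kernel-verified Lean document; each statement's English description precedes it below -/
import Mathlib

section
/- Let α > 0 and β ∈ ℝ with α + β ≥ 1, and let k ∈ ℕ and 0 ≤ r < k. Then the natural density of the set {n ∈ ℕ : Ω(⌊αn + β⌋) ≡ r (mod k)} equals 1/k; that is, lim_{N→∞} |{1 ≤ n ≤ N : k divides Ω(⌊αn+β⌋) − r}| / N = 1/k. -/
open Filter Topology

/-- `bigOmega n` = number of prime factors of `n` counted with multiplicity. -/
def bigOmega (n : ℕ) : ℕ := (Nat.primeFactorsList n).length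

section Tauberian
open scoped FourierTransform

theorem exists_schwartzMap_bump : ∃ ψ : SchwartzMap ℝ ℂ, (∀ ξ, ‖ψ ξ‖ ≤ 1) ∧
    (∀ ξ, 1 < |ξ| → ψ ξ = 0) ∧ ψ 0 = 1 := by
  obtain ⟨f, hts, hc, hd, hr, h0⟩ := exists_contDiff_tsupport_subset (n := ⊤)
    (Metric.ball_mem_nhds (0 : ℝ) one_pos)
  have hc' : HasCompactSupport (fun x => (f x : ℂ)) := hc.comp_left (g := fun x : ℝ => (x : ℂ)) (by simp)
  have hd' : ContDiff ℝ (↑(⊤ : ℕ∞)) (fun x => (f x : ℂ)) := Complex.ofRealCLM.contDiff.comp hd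
  refine ⟨hc'.toSchwartzMap hd', fun ξ => ?_, fun ξ hξ => ?_, ?_⟩
  · have := hr ⟨ξ, rfl⟩
    simpa [abs_of_nonneg this.1] using this.2
  · have : ξ ∉ tsupport f := fun h => by
      have := hts h
      simp at this
      linarith
    simp [image_eq_zero_of_notMem_tsupport this]
  · simp [h0]

theorem SchwartzMap.integral_fourier (ψ : SchwartzMap ℝ ℂ) : ∫ v, (𝓕 ψ) v = ψ 0 := by
  have h : 𝓕⁻ (𝓕 ψ) = ψ := by simp
  have h2 := congrArg (fun f : SchwartzMap ℝ ℂ => f 0) h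
  simp only [SchwartzMap.fourierInv_coe, Real.fourierInv_eq] at h2
  simpa using h2

section
variable {φ : ℝ → ℂ}

theorem integrable_mul_exp_neg (hφm : Measurable φ) (hφb : ∀ u, ‖φ u‖ ≤ 1)
    (hφ0 : ∀ u < 0, φ u = 0) {δ : ℝ} (hδ : 0 < δ) :
    MeasureTheory.Integrable (fun u : ℝ => φ u * Complex.exp (-(δ * u : ℝ))) := by
  have h1 : MeasureTheory.Integrable ((Set.Ici 0).indicator fun u : ℝ => Real.exp (-δ * u)) := by
    rw [MeasureTheory.integrable_indicator_iff measurableSet_Ici, integrableOn_Ici_iff_integrableOn_Ioi]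
    exact exp_neg_integrableOn_Ioi 0 hδ
  refine h1.mono' (by fun_prop) (.of_forall fun u => ?_)
  by_cases hu : 0 ≤ u
  · rw [Set.indicator_of_mem (by exact hu), norm_mul, Complex.norm_exp]
    simpa using mul_le_of_le_one_left (Real.exp_pos _).le (hφb u)
  · simp [hφ0 u (not_le.mp hu), hu]

theorem integral_mul_exp_fourier_eq (hφm : Measurable φ) (hφb : ∀ u, ‖φ u‖ ≤ 1)
    (hφ0 : ∀ u < 0, φ u = 0) (ψ : SchwartzMap ℝ ℂ) (T x : ℝ) {δ : ℝ} (hδ : 0 < δ) :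
    ∫ u : ℝ, φ u * Complex.exp (-(δ * u : ℝ)) * (𝓕 ψ) (T * (u - x)) =
      ∫ ξ : ℝ, 𝐞 (-(ξ * (-(T * x)))) • (ψ ξ *
        ∫ u : ℝ, φ u * Complex.exp (-((δ + (2 * Real.pi * T * ξ : ℝ) * Complex.I) * u))) := by
  have hint := integrable_mul_exp_neg hφm hφb hφ0 hδ
  have hF : MeasureTheory.Integrable (Function.uncurry fun (u ξ : ℝ) =>
      φ u * Complex.exp (-(δ * u : ℝ)) * (𝐞 (-(ξ * (T * (u - x)))) • ψ ξ)) := by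
    refine (hint.mul_prod ψ.integrable).mono ?_ (.of_forall fun z => ?_)
    · have h1 : Continuous fun z : ℝ × ℝ => (𝐞 (-(z.2 * (T * (z.1 - x)))) • ψ z.2 : ℂ) := by
        have := ψ.continuous
        fun_prop
      have h2 : Measurable fun z : ℝ × ℝ => φ z.1 * Complex.exp (-(δ * z.1 : ℝ)) := by fun_prop
      exact (h2.mul h1.measurable).aestronglyMeasurable
    · simp [Function.uncurry, Circle.smul_def, Circle.norm_coe]
  calc _ = ∫ u : ℝ, ∫ ξ : ℝ, φ u * Complex.exp (-(δ * u : ℝ)) * (𝐞 (-(ξ * (T * (u - x)))) • ψ ξ) := by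
        refine MeasureTheory.integral_congr_ae (.of_forall fun u => ?_)
        simp only [SchwartzMap.fourier_coe, Real.fourier_eq]
        rw [MeasureTheory.integral_const_mul]
        simp [mul_comm]
    _ = _ := by
        rw [MeasureTheory.integral_integral_swap hF]
        refine MeasureTheory.integral_congr_ae (.of_forall fun ξ => ?_)
        simp only [Circle.smul_def, smul_eq_mul]
        rw [← MeasureTheory.integral_const_mul, ← MeasureTheory.integral_const_mul]
        refine MeasureTheory.integral_congr_ae (.of_forall fun u => ?_)
        simp only [Real.fourierChar_apply]
        have : Complex.exp (-((δ + (2 * Real.pi * T * ξ : ℝ) * Complex.I) * u)) *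
            Complex.exp ((2 * Real.pi * -(ξ * -(T * x)) : ℝ) * Complex.I) =
            Complex.exp (-(δ * u : ℝ)) * Complex.exp ((2 * Real.pi * -(ξ * (T * (u - x))) : ℝ) * Complex.I) := by
          rw [← Complex.exp_add, ← Complex.exp_add]
          congr 1
          push_cast
          ring
        linear_combination -(φ u * ψ ξ) * this

theorem tendsto_integral_mul_fourier (hφm : Measurable φ) (hφb : ∀ u, ‖φ u‖ ≤ 1)
    (hφ0 : ∀ u < 0, φ u = 0)
    (hdom : ∀ T : ℝ, 0 < T → ∃ g : ℝ → ℝ, MeasureTheory.Integrable g ∧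
      ∀ δ ∈ Set.Ioo (0 : ℝ) 1, ∀ t : ℝ, |t| ≤ T → t ≠ 0 →
        ‖∫ u : ℝ, φ u * Complex.exp (-((δ + t * Complex.I) * u))‖ ≤ g t)
    (hlim : ∀ t : ℝ, t ≠ 0 → ∃ l, Tendsto (fun δ : ℝ =>
      ∫ u : ℝ, φ u * Complex.exp (-((δ + t * Complex.I) * u))) (𝓝[>] 0) (𝓝 l))
    (ψ : SchwartzMap ℝ ℂ) (hψ1 : ∀ ξ, ‖ψ ξ‖ ≤ 1) (hψ : ∀ ξ, 1 < |ξ| → ψ ξ = 0)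
    {T : ℝ} (hT : 0 < T) :
    Tendsto (fun x : ℝ => ∫ u : ℝ, φ u * (𝓕 ψ) (T * (u - x))) atTop (𝓝 0) := by
  choose! G0 hG0 using hlim
  have key (x : ℝ) : ∫ u : ℝ, φ u * (𝓕 ψ) (T * (u - x)) =
      ∫ ξ : ℝ, 𝐞 (-(ξ * (-(T * x)))) • (ψ ξ * G0 (2 * Real.pi * T * ξ)) := by
    have hIoo : Set.Ioo (0 : ℝ) 1 ∈ 𝓝[>] (0 : ℝ) := Ioo_mem_nhdsGT one_pos
    have hK : MeasureTheory.Integrable fun u => (𝓕 ψ) (T * (u - x)) :=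
      ((𝓕 ψ).integrable.comp_mul_left' hT.ne').comp_sub_right x
    have hL : Tendsto (fun δ : ℝ => ∫ u : ℝ, φ u * Complex.exp (-(δ * u : ℝ)) * (𝓕 ψ) (T * (u - x)))
        (𝓝[>] 0) (𝓝 (∫ u : ℝ, φ u * (𝓕 ψ) (T * (u - x)))) := by
      refine MeasureTheory.tendsto_integral_filter_of_dominated_convergence
        (fun u => ‖(𝓕 ψ) (T * (u - x))‖) (.of_forall fun δ => ?_) ?_ hK.norm (.of_forall fun u => ?_)
      · have := (𝓕 ψ).continuous
        exact Measurable.aestronglyMeasurable (by fun_prop)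
      · filter_upwards [hIoo] with δ hδ
        refine .of_forall fun u => ?_
        rw [norm_mul]
        refine mul_le_of_le_one_left (norm_nonneg _) ?_
        by_cases hu : 0 ≤ u
        · rw [norm_mul, Complex.norm_exp]
          refine mul_le_one₀ (hφb u) (Real.exp_pos _).le ?_
          have := mul_nonneg hδ.1.le hu
          simpa using this
        · simp [hφ0 u (not_le.mp hu)]
      · have : Tendsto (fun δ : ℝ => φ u * Complex.exp (-(δ * u : ℝ)) * (𝓕 ψ) (T * (u - x)))
            (𝓝 0) (𝓝 (φ u * Complex.exp (-((0 : ℝ) * u : ℝ)) * (𝓕 ψ) (T * (u - x)))) :=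
          Continuous.tendsto (by fun_prop) 0
        simpa using this.mono_left nhdsWithin_le_nhds
    have hR : Tendsto (fun δ : ℝ => ∫ ξ : ℝ, 𝐞 (-(ξ * (-(T * x)))) • (ψ ξ *
        ∫ u : ℝ, φ u * Complex.exp (-((δ + (2 * Real.pi * T * ξ : ℝ) * Complex.I) * u))))
        (𝓝[>] 0) (𝓝 (∫ ξ : ℝ, 𝐞 (-(ξ * (-(T * x)))) • (ψ ξ * G0 (2 * Real.pi * T * ξ)))) := by
      have hT' : 0 < 2 * Real.pi * T := by positivity
      obtain ⟨g, hg, hgb⟩ := hdom (2 * Real.pi * T) hT'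
      have hne : ∀ᵐ ξ : ℝ, ξ ≠ 0 := by
        simp [MeasureTheory.ae_iff]
      refine MeasureTheory.tendsto_integral_filter_of_dominated_convergence
        (fun ξ => ‖g (2 * Real.pi * T * ξ)‖) (.of_forall fun δ => ?_) ?_
        (hg.comp_mul_left' hT'.ne').norm ?_
      · have h1 : MeasureTheory.StronglyMeasurable fun ξ : ℝ =>
            ∫ u : ℝ, φ u * Complex.exp (-((δ + (2 * Real.pi * T * ξ : ℝ) * Complex.I) * u)) := by
          refine MeasureTheory.StronglyMeasurable.integral_prod_right
            (f := fun ξ u : ℝ => φ u * Complex.exp (-((δ + (2 * Real.pi * T * ξ : ℝ) * Complex.I) * u))) ?_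
          refine Measurable.stronglyMeasurable ?_
          have : Measurable fun z : ℝ × ℝ => φ z.2 := hφm.comp measurable_snd
          exact this.mul (Continuous.measurable (by fun_prop))
        have h2 : Continuous fun ξ : ℝ => (𝐞 (-(ξ * (-(T * x)))) : Circle) := by fun_prop
        have h3 := ψ.continuous
        have h4 := h1.measurable
        refine Measurable.aestronglyMeasurable ?_
        simp only [Circle.smul_def, smul_eq_mul]
        have h5 : Measurable fun ξ : ℝ => ((𝐞 (-(ξ * (-(T * x)))) : Circle) : ℂ) :=
          Continuous.measurable (by fun_prop)
        exact h5.mul (h3.measurable.mul h4)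
      · filter_upwards [hIoo] with δ hδ
        filter_upwards [hne] with ξ hξ
        rw [Circle.smul_def, smul_eq_mul, norm_mul, Circle.norm_coe, one_mul, norm_mul]
        by_cases h : 1 < |ξ|
        · simp [hψ ξ h]
        · refine (mul_le_of_le_one_left (norm_nonneg _) (hψ1 ξ)).trans
            ((hgb δ hδ _ ?_ (by positivity)).trans (Real.le_norm_self _))
          rw [abs_mul, abs_of_pos hT']
          exact mul_le_of_le_one_right hT'.le (not_lt.mp h)
      · filter_upwards [hne] with ξ hξ
        have := hG0 (2 * Real.pi * T * ξ) (by positivity)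
        exact (this.const_mul _).const_smul _
    refine tendsto_nhds_unique (hL.congr' ?_) hR
    filter_upwards [self_mem_nhdsWithin] with δ hδ
    exact integral_mul_exp_fourier_eq hφm hφb hφ0 ψ T x hδ
  simp only [key]
  refine (Real.tendsto_integral_exp_smul_cocompact
    (fun ξ : ℝ => ψ ξ * G0 (2 * Real.pi * T * ξ))).comp (f := fun x : ℝ => -(T * x)) ?_
  refine Tendsto.mono_right ?_ atBot_le_cocompact
  exact tendsto_neg_atTop_atBot.comp (tendsto_id.const_mul_atTop hT)

/-- A Tauberian theorem for slowly varying bounded functions whose Laplace transform has dominated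
boundary values on the imaginary axis. -/
theorem tendsto_zero_of_laplace (hφm : Measurable φ) (hφb : ∀ u, ‖φ u‖ ≤ 1)
    (hφ0 : ∀ u < 0, φ u = 0)
    (hslow : ∀ x ≥ (1 : ℝ), ∀ y, ‖φ x - φ y‖ ≤ 4 * |x - y| + Real.exp (-(x / 2)))
    (hdom : ∀ T : ℝ, 0 < T → ∃ g : ℝ → ℝ, MeasureTheory.Integrable g ∧
      ∀ δ ∈ Set.Ioo (0 : ℝ) 1, ∀ t : ℝ, |t| ≤ T → t ≠ 0 →
        ‖∫ u : ℝ, φ u * Complex.exp (-((δ + t * Complex.I) * u))‖ ≤ g t)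
    (hlim : ∀ t : ℝ, t ≠ 0 → ∃ l, Tendsto (fun δ : ℝ =>
      ∫ u : ℝ, φ u * Complex.exp (-((δ + t * Complex.I) * u))) (𝓝[>] 0) (𝓝 l)) :
    Tendsto φ atTop (𝓝 0) := by
  obtain ⟨ψ, hψ1, hψ, hψ0⟩ := exists_schwartzMap_bump
  set K := 𝓕 ψ with hK
  have hK1 : ∫ v, K v = 1 := by rw [hK, SchwartzMap.integral_fourier, hψ0]
  have hKi : MeasureTheory.Integrable (fun v => ‖K v‖) := K.integrable.norm
  have hKv : MeasureTheory.Integrable (fun v => |v| * ‖K v‖) := by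
    simpa using K.integrable_pow_mul MeasureTheory.volume 1
  set A := ∫ v, |v| * ‖K v‖
  set B := ∫ v, ‖K v‖
  have hA : 0 ≤ A := MeasureTheory.integral_nonneg fun v => by positivity
  have hmain (T : ℝ) (hT : 0 < T) (x : ℝ) (hx : 1 ≤ x) :
      ‖φ x‖ ≤ T * ‖∫ u : ℝ, φ u * K (T * (u - x))‖ + (4 / T * A + Real.exp (-(x / 2)) * B) := by
    have hsub : T * ∫ u : ℝ, φ u * K (T * (u - x)) = ∫ v, φ (x + v / T) * K v := by
      have h1 := MeasureTheory.integral_sub_right_eq_self (fun u => φ (x + u) * K (T * u)) x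
        (μ := MeasureTheory.volume)
      have h2 := MeasureTheory.Measure.integral_comp_mul_left (fun v => φ (x + v / T) * K v) T
      rw [abs_of_pos (inv_pos.2 hT)] at h2
      have h3 : ∀ u, φ (x + T * u / T) * K (T * u) = φ (x + u) * K (T * u) := fun u => by
        rw [mul_div_cancel_left₀ _ hT.ne']
      simp only [h3] at h2
      simp only [add_sub_cancel] at h1
      rw [h1, h2, Complex.real_smul, ← mul_assoc]
      push_cast
      rw [mul_inv_cancel₀ (by exact_mod_cast hT.ne'), one_mul]
    have hi : MeasureTheory.Integrable fun v => φ (x + v / T) * K v := by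
      refine hKi.mono' ?_ (.of_forall fun v => ?_)
      · have := K.continuous
        exact Measurable.aestronglyMeasurable (by fun_prop)
      · rw [norm_mul]
        exact mul_le_of_le_one_left (norm_nonneg _) (hφb _)
    have hdiff : φ x - T * ∫ u : ℝ, φ u * K (T * (u - x)) = ∫ v, (φ x - φ (x + v / T)) * K v := by
      simp only [sub_mul]
      rw [hsub, MeasureTheory.integral_sub (K.integrable.const_mul _) hi,
        MeasureTheory.integral_const_mul, hK1, mul_one]
    have hbd : ‖∫ v, (φ x - φ (x + v / T)) * K v‖ ≤ 4 / T * A + Real.exp (-(x / 2)) * B := by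
      rw [← MeasureTheory.integral_const_mul, ← MeasureTheory.integral_const_mul,
        ← MeasureTheory.integral_add (hKv.const_mul _) (hKi.const_mul _)]
      refine MeasureTheory.norm_integral_le_of_norm_le
        ((hKv.const_mul _).add (hKi.const_mul _)) (.of_forall fun v => ?_)
      rw [norm_mul]
      have := mul_le_mul_of_nonneg_right (hslow x hx (x + v / T)) (norm_nonneg (K v))
      rw [sub_add_cancel_left, abs_neg, abs_div, abs_of_pos hT] at this
      refine this.trans_eq ?_
      ring
    calc ‖φ x‖ = ‖T * (∫ u : ℝ, φ u * K (T * (u - x))) +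
          (φ x - T * ∫ u : ℝ, φ u * K (T * (u - x)))‖ := by rw [add_sub_cancel]
      _ ≤ _ := by
        refine (norm_add_le _ _).trans (add_le_add ?_ (hdiff ▸ hbd))
        rw [norm_mul, Complex.norm_real, Real.norm_of_nonneg hT.le]
  rw [NormedAddGroup.tendsto_nhds_zero]
  intro ε hε
  set T := 8 * (A + 1) / ε with hTdef
  have hT : 0 < T := by positivity
  have hTA : 4 / T * A < ε / 2 := by
    rw [hTdef]
    have : 4 / (8 * (A + 1) / ε) * A = ε / 2 * (A / (A + 1)) := by field_simp; ring
    rw [this]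
    exact mul_lt_of_lt_one_right (by positivity) ((div_lt_one (by positivity)).2 (by linarith))
  have hlim2 : Tendsto (fun x : ℝ => T * ‖∫ u : ℝ, φ u * K (T * (u - x))‖ +
      (4 / T * A + Real.exp (-(x / 2)) * B)) atTop (𝓝 (T * 0 + (4 / T * A + 0 * B))) := by
    have h1 := (tendsto_integral_mul_fourier hφm hφb hφ0 hdom hlim ψ hψ1 hψ hT).norm
    rw [norm_zero] at h1
    refine (h1.const_mul T).add (tendsto_const_nhds.add (Tendsto.mul_const _ ?_))
    exact Real.tendsto_exp_neg_atTop_nhds_zero.comp (tendsto_id.atTop_div_const two_pos)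
  have := hlim2.eventually_lt_const (u := ε) (by linarith)
  filter_upwards [this, eventually_ge_atTop 1] with x hx hx1
  exact (hmain T hT x hx1).trans_lt hx
end

end Tauberian

/-- The arithmetic function `a` has mean value zero. -/
def MeanZero (a : ℕ → ℂ) : Prop :=
  Tendsto (fun N : ℕ => (∑ n ∈ Finset.Icc 1 N, a n) / (N : ℂ)) atTop (𝓝 0)

section
variable {f : ℕ → ℂ}

theorem norm_sum_Icc_le (hf : ∀ n, ‖f n‖ ≤ 1) (m : ℕ) : ‖∑ n ∈ Finset.Icc 1 m, f n‖ ≤ m := by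
  simpa using norm_sum_le_of_le (Finset.Icc 1 m) fun n _ => hf n

theorem norm_sum_Icc_sub_sum_Icc_le (hf : ∀ n, ‖f n‖ ≤ 1) {m n : ℕ} (h : m ≤ n) :
    ‖∑ i ∈ Finset.Icc 1 n, f i - ∑ i ∈ Finset.Icc 1 m, f i‖ ≤ (n : ℝ) - m := by
  rw [← Finset.sum_sdiff (Finset.Icc_subset_Icc_right h : Finset.Icc 1 m ⊆ Finset.Icc 1 n),
    add_sub_cancel_right]
  refine (norm_sum_le_of_le _ fun i _ => hf i).trans ?_
  simp [Finset.card_sdiff_of_subset (Finset.Icc_subset_Icc_right h : Finset.Icc 1 m ⊆ Finset.Icc 1 n),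
    Nat.cast_sub h]

/-- The normalised summatory function in the logarithmic scale. -/
noncomputable def logMean (f : ℕ → ℂ) (u : ℝ) : ℂ :=
  if 0 ≤ u then (∑ n ∈ Finset.Icc 1 ⌊Real.exp u⌋₊, f n) * (Real.exp (-u) : ℂ) else 0

theorem measurable_logMean (f : ℕ → ℂ) : Measurable (logMean f) := by
  refine Measurable.ite measurableSet_Ici (Measurable.mul ?_ ?_) measurable_const
  · exact (measurable_from_nat (f := fun m : ℕ => ∑ n ∈ Finset.Icc 1 m, f n)).comp
      (Nat.measurable_floor.comp Real.measurable_exp)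
  · fun_prop

theorem norm_logMean_le (hf : ∀ n, ‖f n‖ ≤ 1) (u : ℝ) : ‖logMean f u‖ ≤ 1 := by
  rw [logMean]
  split_ifs with h
  · rw [norm_mul, Complex.norm_real, Real.norm_of_nonneg (Real.exp_pos _).le]
    calc _ ≤ Real.exp u * Real.exp (-u) := by
          gcongr
          exact (norm_sum_Icc_le hf _).trans (Nat.floor_le (Real.exp_pos _).le)
      _ = 1 := by rw [← Real.exp_add, add_neg_cancel, Real.exp_zero]
  · simp

theorem norm_logMean_sub_le (hf : ∀ n, ‖f n‖ ≤ 1) {a b : ℝ} (ha : 0 ≤ a) (hab : a ≤ b) :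
    ‖logMean f b - logMean f a‖ ≤ 2 * (b - a) + Real.exp (-b) := by
  rw [logMean, logMean, if_pos ha, if_pos (ha.trans hab)]
  set S : ℝ → ℂ := fun u => ∑ n ∈ Finset.Icc 1 ⌊Real.exp u⌋₊, f n
  have h1 : ‖S b - S a‖ ≤ Real.exp b - Real.exp a + 1 := by
    refine (norm_sum_Icc_sub_sum_Icc_le hf (Nat.floor_mono (Real.exp_le_exp.2 hab))).trans ?_
    have := Nat.floor_le (Real.exp_pos b).le
    have := Nat.lt_floor_add_one (Real.exp a)
    linarith
  have h2 : ‖S a‖ ≤ Real.exp a :=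
    (norm_sum_Icc_le hf _).trans (Nat.floor_le (Real.exp_pos _).le)
  have h3 : 1 - Real.exp (a - b) ≤ b - a := by
    have := Real.add_one_le_exp (a - b)
    linarith
  have h4 : Real.exp (-b) ≤ Real.exp (-a) := Real.exp_le_exp.2 (by linarith)
  calc ‖S b * (Real.exp (-b) : ℂ) - S a * (Real.exp (-a) : ℂ)‖
      = ‖(S b - S a) * (Real.exp (-b) : ℂ) - S a * ((Real.exp (-a) - Real.exp (-b) : ℝ) : ℂ)‖ := by
        congr 1; push_cast; ring
    _ ≤ (Real.exp b - Real.exp a + 1) * Real.exp (-b) +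
          Real.exp a * (Real.exp (-a) - Real.exp (-b)) := by
        refine (norm_sub_le _ _).trans (add_le_add ?_ ?_)
        · rw [norm_mul, Complex.norm_real, Real.norm_of_nonneg (Real.exp_pos _).le]
          gcongr
        · rw [norm_mul, Complex.norm_real, Real.norm_of_nonneg (sub_nonneg.2 h4)]
          gcongr
    _ = 2 * (1 - Real.exp (a - b)) + Real.exp (-b) := by
        have e1 : Real.exp b * Real.exp (-b) = 1 := by rw [← Real.exp_add]; simp
        have e2 : Real.exp a * Real.exp (-a) = 1 := by rw [← Real.exp_add]; simp
        have e3 : Real.exp a * Real.exp (-b) = Real.exp (a - b) := by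
          rw [← Real.exp_add, sub_eq_add_neg]
        linear_combination e1 + e2 - 2 * e3
    _ ≤ _ := by linarith

theorem norm_logMean_sub_le_of_one_le (hf : ∀ n, ‖f n‖ ≤ 1) {x : ℝ} (hx : 1 ≤ x) (y : ℝ) :
    ‖logMean f x - logMean f y‖ ≤ 4 * |x - y| + Real.exp (-(x / 2)) := by
  have hexp : Real.exp (-x) ≤ Real.exp (-(x / 2)) := Real.exp_le_exp.2 (by linarith)
  rcases lt_or_ge y 0 with hy | hy
  · have : logMean f y = 0 := if_neg (not_le.2 hy)
    rw [this, sub_zero, abs_of_pos (by linarith)]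
    linarith [norm_logMean_le hf x, Real.exp_pos (-(x / 2))]
  rcases le_total x y with h | h
  · rw [norm_sub_rev, abs_of_nonpos (by linarith)]
    have := norm_logMean_sub_le hf (by linarith : (0 : ℝ) ≤ x) h
    have h2 : Real.exp (-y) ≤ Real.exp (-x) := Real.exp_le_exp.2 (by linarith)
    linarith
  · rw [abs_of_nonneg (by linarith)]
    have := norm_logMean_sub_le hf hy h
    linarith

theorem laplace_logMean (hf : ∀ n, ‖f n‖ ≤ 1) {z : ℂ} (hz : 0 < z.re) :
    ∫ u : ℝ, logMean f u * Complex.exp (-(z * u)) = LSeries f (1 + z) / (1 + z) := by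
  have hs : 1 < (1 + z).re := by simpa using hz
  have hne : 1 + z ≠ 0 := fun h => by rw [h] at hs; norm_num at hs
  have hO : (fun n : ℕ => ∑ k ∈ Finset.Icc 1 n, ‖f k‖) =O[atTop] fun n => (n : ℝ) ^ (1 : ℝ) := by
    refine Asymptotics.isBigO_of_le _ fun n => ?_
    rw [Real.rpow_one, Real.norm_of_nonneg (Finset.sum_nonneg fun _ _ => norm_nonneg _)]
    simpa using Finset.sum_le_sum fun k (_ : k ∈ Finset.Icc 1 n) => hf k
  rw [LSeries_eq_mul_integral' f zero_le_one hs hO, mul_div_cancel_left₀ _ hne]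
  have h1 := MeasureTheory.integral_comp_exp_Ioi
    (fun t : ℝ => (∑ k ∈ Finset.Icc 1 ⌊t⌋₊, f k) * (t : ℂ) ^ (-(1 + z + 1))) 0
  rw [Real.exp_zero] at h1
  rw [← h1, ← MeasureTheory.integral_Ici_eq_integral_Ioi,
    ← MeasureTheory.integral_indicator measurableSet_Ici]
  refine MeasureTheory.integral_congr_ae (.of_forall fun u => ?_)
  by_cases hu : 0 ≤ u
  · simp only [logMean, if_pos hu, Set.indicator_of_mem (show u ∈ Set.Ici 0 from hu)]
    rw [Complex.real_smul, Complex.ofReal_exp, Complex.ofReal_exp,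
      Complex.cpow_def_of_ne_zero (Complex.exp_ne_zero _), ← Complex.ofReal_exp u,
      ← Complex.ofReal_log (Real.exp_pos u).le, Real.log_exp, Complex.ofReal_exp u,
      mul_left_comm, mul_assoc, ← Complex.exp_add, ← Complex.exp_add]
    congr 2
    push_cast
    ring
  · simp [logMean, hu]

theorem meanZero_of_LSeries (hf : ∀ n, ‖f n‖ ≤ 1)
    (hdom : ∀ T : ℝ, 0 < T → ∃ g : ℝ → ℝ, MeasureTheory.Integrable g ∧
      ∀ δ ∈ Set.Ioo (0 : ℝ) 1, ∀ t : ℝ, |t| ≤ T → t ≠ 0 →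
        ‖LSeries f (1 + (δ + t * Complex.I))‖ ≤ g t)
    (hlim : ∀ t : ℝ, t ≠ 0 → ∃ l, Tendsto (fun δ : ℝ => LSeries f (1 + (δ + t * Complex.I)))
      (𝓝[>] 0) (𝓝 l)) : MeanZero f := by
  have key : Tendsto (logMean f) atTop (𝓝 0) := by
    refine tendsto_zero_of_laplace (measurable_logMean f) (norm_logMean_le hf)
      (fun u hu => if_neg (not_le.2 hu)) (fun x hx => norm_logMean_sub_le_of_one_le hf hx) ?_ ?_
    · intro T hT
      obtain ⟨g, hg, hb⟩ := hdom T hT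
      refine ⟨g, hg, fun δ hδ t ht ht0 => ?_⟩
      rw [laplace_logMean hf (by simpa using hδ.1), norm_div]
      refine (div_le_self (norm_nonneg _) ?_).trans (hb δ hδ t ht ht0)
      have := Complex.re_le_norm (1 + (δ + t * Complex.I))
      have h : (1 + (δ + t * Complex.I) : ℂ).re = 1 + δ := by simp
      linarith [hδ.1]
    · intro t ht
      obtain ⟨l, hl⟩ := hlim t ht
      have hne : (1 + ((0 : ℝ) + t * Complex.I) : ℂ) ≠ 0 := fun h => by
        simpa using congrArg Complex.re h
      have hd : Tendsto (fun δ : ℝ => (1 + (δ + t * Complex.I) : ℂ)) (𝓝[>] 0)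
          (𝓝 (1 + ((0 : ℝ) + t * Complex.I))) :=
        (Continuous.tendsto (f := fun δ : ℝ => (1 + (δ + t * Complex.I) : ℂ)) (by fun_prop) 0).mono_left
          nhdsWithin_le_nhds
      refine ⟨_, (hl.div hd hne).congr' ?_⟩
      filter_upwards [self_mem_nhdsWithin] with δ hδ
      exact (laplace_logMean hf (by simpa using hδ)).symm
  have h2 := key.comp (Real.tendsto_log_atTop.comp (tendsto_natCast_atTop_atTop (R := ℝ)))
  refine h2.congr' ?_
  filter_upwards [eventually_ge_atTop 1] with N hN
  have hN' : (1 : ℝ) ≤ N := by exact_mod_cast hN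
  have hN0 : (0 : ℝ) < N := by linarith
  simp only [Function.comp, logMean, if_pos (Real.log_nonneg hN')]
  rw [Real.exp_log hN0, Nat.floor_natCast, Real.exp_neg, Real.exp_log hN0, div_eq_mul_inv]
  push_cast
  rfl
end

theorem bigOmega_one : bigOmega 1 = 0 := by simp [bigOmega]

theorem bigOmega_mul {m n : ℕ} (hm : m ≠ 0) (hn : n ≠ 0) :
    bigOmega (m * n) = bigOmega m + bigOmega n := by
  simp [bigOmega, (Nat.perm_primeFactorsList_mul hm hn).length_eq]

theorem bigOmega_prime {p : ℕ} (hp : p.Prime) : bigOmega p = 1 := by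
  simp [bigOmega, Nat.primeFactorsList_prime hp]

/-- A continuous logarithm of a continuous function on `1 < re s` extends continuously to boundary
points at which the function does not vanish. -/
theorem exists_tendsto_of_exp_eq {l L : ℂ → ℂ} (hl : ContinuousOn l {s | 1 < s.re})
    (hL : Continuous L) (hexp : ∀ s : ℂ, 1 < s.re → Complex.exp (l s) = L s) {s₀ : ℂ}
    (hs₀ : L s₀ ≠ 0) : ∃ y, Tendsto l (𝓝[{s | 1 < s.re}] s₀) (𝓝 y) := by
  have hcont : Continuous fun s => L s / L s₀ := hL.div_const _
  have h1 : ∀ᶠ s in 𝓝 s₀, L s / L s₀ ∈ Complex.slitPlane :=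
    hcont.continuousAt.eventually_mem (Complex.isOpen_slitPlane.mem_nhds (by simp [hs₀]))
  obtain ⟨r, hr, hball⟩ := Metric.eventually_nhds_iff_ball.1 h1
  set V := Metric.ball s₀ r ∩ {s : ℂ | 1 < s.re} with hV
  have hVc : IsPreconnected V :=
    ((convex_ball s₀ r).inter (convex_halfSpace_re_gt 1)).isPreconnected
  have hVn : V ∈ 𝓝[{s | 1 < s.re}] s₀ :=
    Filter.inter_mem (mem_nhdsWithin_of_mem_nhds (Metric.ball_mem_nhds _ hr)) self_mem_nhdsWithin
  have hlogc : ContinuousOn (fun s => Complex.log (L s / L s₀)) V :=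
    hcont.continuousOn.clog fun s hs => hball s hs.1
  have hpi : (2 * Real.pi * Complex.I : ℂ) ≠ 0 := Complex.two_pi_I_ne_zero
  obtain ⟨y, -, hy⟩ := hVc.eqOn_const_of_mapsTo (T := Set.range ((↑) : ℤ → ℂ))
    ⟨(Complex.isClosedEmbedding_intCast.isEmbedding.toHomeomorph.discreteTopology :)⟩
    (f := fun s => (l s - Complex.log (L s / L s₀) - Complex.log (L s₀)) / (2 * Real.pi * Complex.I))
    ((((hl.mono Set.inter_subset_right).sub hlogc).sub continuousOn_const).div_const _)
    (fun s hs => by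
      have h2 : Complex.exp (l s - Complex.log (L s / L s₀) - Complex.log (L s₀)) = 1 := by
        have h3 := Complex.slitPlane_ne_zero (hball s hs.1)
        rw [Complex.exp_sub, Complex.exp_sub, hexp s hs.2, Complex.exp_log h3, Complex.exp_log hs₀]
        have : L s ≠ 0 := fun h => by simp [h] at h3
        field_simp
      obtain ⟨n, hn⟩ := Complex.exp_eq_one_iff.1 h2
      exact ⟨n, by simp only [hn]; field_simp⟩) (Set.range_nonempty _)
  refine ⟨Complex.log (L s₀ / L s₀) + (y * (2 * Real.pi * Complex.I) + Complex.log (L s₀)), ?_⟩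
  have h4 : Tendsto (fun s => Complex.log (L s / L s₀) + (y * (2 * Real.pi * Complex.I) + Complex.log (L s₀)))
      (𝓝[{s | 1 < s.re}] s₀)
      (𝓝 (Complex.log (L s₀ / L s₀) + (y * (2 * Real.pi * Complex.I) + Complex.log (L s₀)))) := by
    refine Tendsto.add_const _ (Tendsto.mono_left ?_ nhdsWithin_le_nhds)
    exact (hcont.continuousAt.clog (by simp [hs₀])).tendsto
  refine h4.congr' ?_
  filter_upwards [hVn] with s hs
  have h5 := hy hs
  simp only [Function.const] at h5
  rw [← h5, div_mul_cancel₀ _ hpi]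
  ring

section DirichletTwist
variable {q : ℕ} (χ : DirichletCharacter ℂ q)

theorem norm_character_mul_cpow_le (p : Nat.Primes) (s : ℂ) :
    ‖χ p * (p : ℂ) ^ (-s)‖ ≤ (p : ℝ) ^ (-s.re) := by
  rw [norm_mul, Complex.norm_natCast_cpow_of_pos p.2.pos, Complex.neg_re]
  exact mul_le_of_le_one_left (by positivity) (χ.norm_le_one _)

theorem primes_rpow_le {σ τ : ℝ} (h : τ ≤ σ) (p : Nat.Primes) :
    (p : ℝ) ^ (-σ) ≤ (p : ℝ) ^ (-τ) :=
  Real.rpow_le_rpow_of_exponent_le (by exact_mod_cast p.2.one_lt.le) (by linarith)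

theorem norm_character_mul_cpow_le_half (p : Nat.Primes) {s : ℂ} (hs : 1 ≤ s.re) :
    ‖χ p * (p : ℂ) ^ (-s)‖ ≤ 1 / 2 := by
  refine (norm_character_mul_cpow_le χ p s).trans ((primes_rpow_le hs p).trans ?_)
  rw [Real.rpow_neg_one, one_div]
  gcongr
  exact_mod_cast p.2.two_le

theorem continuous_character_mul_cpow (p : Nat.Primes) :
    Continuous fun s : ℂ => χ p * (p : ℂ) ^ (-s) := by
  have : (p : ℂ) ≠ 0 := by exact_mod_cast p.2.ne_zero
  exact continuous_const.mul (continuous_neg.const_cpow (Or.inl this))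

theorem continuousOn_log_one_sub_character {w : ℂ} (hw : ‖w‖ ≤ 1) (p : Nat.Primes) :
    ContinuousOn (fun s : ℂ => Complex.log (1 - w * (χ p * (p : ℂ) ^ (-s)))) {s | 1 ≤ s.re} := by
  refine ContinuousOn.clog ?_ fun s hs => ?_
  · exact (continuous_const.sub (continuous_const.mul (continuous_character_mul_cpow χ p))).continuousOn
  · rw [sub_eq_add_neg]
    refine Complex.mem_slitPlane_of_norm_lt_one ?_
    rw [norm_neg, norm_mul]
    exact (mul_le_of_le_one_left (norm_nonneg _) hw).trans_lt
      ((norm_character_mul_cpow_le_half χ p hs).trans_lt (by norm_num))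

theorem norm_log_one_sub_add_le {z : ℂ} (hz : ‖z‖ ≤ 1 / 2) : ‖Complex.log (1 - z) + z‖ ≤ ‖z‖ ^ 2 := by
  have h := Complex.norm_log_one_add_sub_self_le (z := -z) (by rw [norm_neg]; linarith)
  rw [norm_neg, ← sub_eq_add_neg, sub_neg_eq_add] at h
  refine h.trans ?_
  have : (1 - ‖z‖)⁻¹ ≤ 2 := by
    rw [inv_le_comm₀ (by linarith) two_pos]
    linarith
  nlinarith [sq_nonneg ‖z‖]

theorem norm_log_one_sub_le {z : ℂ} (hz : ‖z‖ ≤ 1 / 2) : ‖Complex.log (1 - z)‖ ≤ 3 / 2 * ‖z‖ := by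
  simpa [sub_eq_add_neg] using Complex.norm_log_one_add_half_le_self (z := -z) (by rwa [norm_neg])

/-- The logarithm of the Euler product of `L(s, χ)`. -/
noncomputable def logEuler (s : ℂ) : ℂ := ∑' p : Nat.Primes, -Complex.log (1 - χ p * (p : ℂ) ^ (-s))

/-- The difference between the logarithm of the `w`-twisted Euler product and `w` times the
logarithm of the Euler product. -/
noncomputable def eulerDefect (w s : ℂ) : ℂ := ∑' p : Nat.Primes,
  (-Complex.log (1 - w * (χ p * (p : ℂ) ^ (-s))) + w * Complex.log (1 - χ p * (p : ℂ) ^ (-s)))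

theorem continuousOn_logEuler : ContinuousOn (logEuler χ) {s | 1 < s.re} := by
  intro s hs
  obtain ⟨σ, hσ1, hσs⟩ := exists_between (show 1 < s.re from hs)
  have h : ContinuousOn (logEuler χ) {s | σ < s.re} := by
    refine continuousOn_tsum (u := fun p : Nat.Primes => 3 / 2 * (p : ℝ) ^ (-σ)) (fun p => ?_)
      ((Nat.Primes.summable_rpow.2 (by linarith)).mul_left _) fun p z hz => ?_
    · have := (continuousOn_log_one_sub_character χ (w := 1) (by simp) p).neg
      simp only [one_mul] at this
      exact this.mono fun z hz => (hσ1.trans hz).le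
    · rw [norm_neg]
      refine (norm_log_one_sub_le (norm_character_mul_cpow_le_half χ p (hσ1.trans hz).le)).trans ?_
      gcongr
      exact (norm_character_mul_cpow_le χ p z).trans (primes_rpow_le (le_of_lt hz) p)
  exact ((h s hσs).continuousAt
    ((isOpen_lt continuous_const Complex.continuous_re).mem_nhds hσs)).continuousWithinAt

theorem norm_eulerDefect_term_le {w : ℂ} (hw : ‖w‖ ≤ 1) (p : Nat.Primes) {s : ℂ} (hs : 1 ≤ s.re) :
    ‖-Complex.log (1 - w * (χ p * (p : ℂ) ^ (-s))) + w * Complex.log (1 - χ p * (p : ℂ) ^ (-s))‖ ≤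
      2 * (p : ℝ) ^ (-2 : ℝ) := by
  set z := χ p * (p : ℂ) ^ (-s)
  have hz : ‖z‖ ≤ 1 / 2 := norm_character_mul_cpow_le_half χ p hs
  have hz1 : ‖z‖ ≤ (p : ℝ) ^ (-1 : ℝ) :=
    (norm_character_mul_cpow_le χ p s).trans (primes_rpow_le hs p)
  have hwz : ‖w * z‖ ≤ ‖z‖ := by
    rw [norm_mul]
    exact mul_le_of_le_one_left (norm_nonneg _) hw
  have h2 : (p : ℝ) ^ (-2 : ℝ) = ((p : ℝ) ^ (-1 : ℝ)) ^ 2 := by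
    rw [← Real.rpow_natCast, ← Real.rpow_mul (by positivity)]
    norm_num
  have hsq : ‖z‖ ^ 2 ≤ (p : ℝ) ^ (-2 : ℝ) := by
    rw [h2]
    gcongr
  calc _ = ‖-(Complex.log (1 - w * z) + w * z) + w * (Complex.log (1 - z) + z)‖ := by
        congr 1; ring
    _ ≤ ‖w * z‖ ^ 2 + 1 * ‖z‖ ^ 2 := by
        refine (norm_add_le _ _).trans (add_le_add ?_ ?_)
        · rw [norm_neg]
          exact norm_log_one_sub_add_le (hwz.trans hz)
        · rw [norm_mul]
          gcongr
          exact norm_log_one_sub_add_le hz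
    _ ≤ ‖z‖ ^ 2 + 1 * ‖z‖ ^ 2 := by gcongr
    _ ≤ _ := by linarith

theorem summable_two_mul_primes_rpow : Summable fun p : Nat.Primes => 2 * (p : ℝ) ^ (-2 : ℝ) :=
  (Nat.Primes.summable_rpow.2 (by norm_num)).mul_left _

theorem continuousOn_eulerDefect {w : ℂ} (hw : ‖w‖ ≤ 1) :
    ContinuousOn (eulerDefect χ w) {s | 1 ≤ s.re} := by
  refine continuousOn_tsum (fun p => ?_) summable_two_mul_primes_rpow
    fun p z hz => norm_eulerDefect_term_le χ hw p hz
  have h1 := continuousOn_log_one_sub_character χ hw p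
  have h2 := continuousOn_log_one_sub_character χ (w := 1) (by simp) p
  simp only [one_mul] at h2
  exact h1.neg.add (continuousOn_const.mul h2)

/-- The completely multiplicative summand `w ^ Ω(n) * χ n * n ^ (-s)`. -/
noncomputable def omegaSummandHom (w : ℂ) {s : ℂ} (hs : s ≠ 0) : ℕ →*₀ ℂ where
  toFun n := w ^ bigOmega n * (dirichletSummandHom χ hs n)
  map_zero' := by simp
  map_one' := by simp [bigOmega_one]
  map_mul' m n := by
    rcases eq_or_ne m 0 with rfl | hm
    · simp
    rcases eq_or_ne n 0 with rfl | hn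
    · simp
    rw [bigOmega_mul hm hn, pow_add, map_mul]
    ring

theorem LSeries_omega_eq {w : ℂ} (hw : ‖w‖ ≤ 1) {s : ℂ} (hs : 1 < s.re) :
    LSeries (fun n => w ^ bigOmega n * χ n) s =
      Complex.exp (w * logEuler χ s + eulerDefect χ w s) := by
  have hs0 : s ≠ 0 := Complex.ne_zero_of_one_lt_re hs
  have hsum : Summable fun n => ‖omegaSummandHom χ w hs0 n‖ := by
    refine (summable_dirichletSummand χ hs).of_nonneg_of_le (fun _ => norm_nonneg _) fun n => ?_
    change ‖w ^ bigOmega n * dirichletSummandHom χ hs0 n‖ ≤ _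
    rw [norm_mul, norm_pow]
    exact mul_le_of_le_one_left (norm_nonneg _) (pow_le_one₀ (norm_nonneg _) hw)
  have hterm (n : ℕ) : LSeries.term (fun n => w ^ bigOmega n * χ n) s n = omegaSummandHom χ w hs0 n := by
    change _ = w ^ bigOmega n * (χ n * (n : ℂ) ^ (-s))
    rw [LSeries.term_of_ne_zero' hs0, Complex.cpow_neg, div_eq_mul_inv, mul_assoc]
  have hprime (p : Nat.Primes) : omegaSummandHom χ w hs0 p = w * (χ p * (p : ℂ) ^ (-s)) := by
    change w ^ bigOmega p * (χ p * (p : ℂ) ^ (-s)) = _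
    rw [bigOmega_prime p.2, pow_one]
  rw [LSeries, tsum_congr hterm, ← EulerProduct.exp_tsum_primes_log_eq_tsum hsum, logEuler,
    eulerDefect]
  have hs1 : Summable fun p : Nat.Primes => -Complex.log (1 - χ p * (p : ℂ) ^ (-s)) := by
    refine Summable.of_norm_bounded (g := fun p : Nat.Primes => 3 / 2 * (p : ℝ) ^ (-s.re))
      ((Nat.Primes.summable_rpow.2 (by linarith)).mul_left _) fun p => ?_
    rw [norm_neg]
    refine (norm_log_one_sub_le (norm_character_mul_cpow_le_half χ p hs.le)).trans ?_
    gcongr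
    exact norm_character_mul_cpow_le χ p s
  have hs2 : Summable fun p : Nat.Primes => (-Complex.log (1 - w * (χ p * (p : ℂ) ^ (-s))) +
      w * Complex.log (1 - χ p * (p : ℂ) ^ (-s))) :=
    Summable.of_norm_bounded summable_two_mul_primes_rpow
      fun p => norm_eulerDefect_term_le χ hw p hs.le
  rw [← tsum_mul_left, ← (hs1.mul_left w).tsum_add hs2]
  congr 1
  refine tsum_congr fun p => ?_
  rw [hprime]
  ring

theorem exp_logEuler [NeZero q] {s : ℂ} (hs : 1 < s.re) :
    Complex.exp (logEuler χ s) = DirichletCharacter.LFunction χ s := by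
  rw [DirichletCharacter.LFunction_eq_LSeries χ hs, logEuler,
    DirichletCharacter.LSeries_eulerProduct_exp_log χ hs]

theorem exists_regularized_LFunction [NeZero q] : ∃ (e : ℂ) (L : ℂ → ℂ), (e = 0 ∨ e = 1) ∧
    Continuous L ∧ (∀ s : ℂ, 1 ≤ s.re → L s ≠ 0) ∧
    ∀ s : ℂ, 1 < s.re → L s = Complex.exp (logEuler χ s + e * Complex.log (s - 1)) := by
  by_cases hχ : χ = 1
  · refine ⟨1, DirichletCharacter.LFunctionTrivChar₁ q, Or.inr rfl,
      (DirichletCharacter.differentiable_LFunctionTrivChar₁ q).continuous, fun s hs => ?_, fun s hs => ?_⟩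
    · rcases eq_or_ne s 1 with rfl | h1
      · exact DirichletCharacter.LFunctionTrivChar₁_apply_one_ne_zero q
      · rw [DirichletCharacter.LFunctionTrivChar₁, Function.update_of_ne h1, mul_ne_zero_iff]
        exact ⟨sub_ne_zero.2 h1, DirichletCharacter.LFunction_ne_zero_of_one_le_re 1 (.inr h1) hs⟩
    · have h1 : s ≠ 1 := fun h => by simp [h] at hs
      rw [Complex.exp_add, exp_logEuler χ hs, one_mul, Complex.exp_log (sub_ne_zero.2 h1),
        DirichletCharacter.LFunctionTrivChar₁, Function.update_of_ne h1, hχ, mul_comm]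
  · refine ⟨0, DirichletCharacter.LFunction χ, Or.inl rfl,
      (DirichletCharacter.differentiable_LFunction hχ).continuous,
      fun s hs => DirichletCharacter.LFunction_ne_zero_of_one_le_re χ (.inl hχ) hs, fun s hs => ?_⟩
    rw [zero_mul, add_zero, exp_logEuler χ hs]

/-- Up to a power of `s - 1`, the Dirichlet series of `w ^ Ω(n) * χ n` extends continuously to the
closed half-plane `1 ≤ re s`. -/
theorem exists_LSeries_omega_eq_mul_exp [NeZero q] {w : ℂ} (hw : ‖w‖ ≤ 1) :
    ∃ (e : ℂ) (H : ℂ → ℂ), (e = 0 ∨ e = 1) ∧ ContinuousOn H {s | 1 ≤ s.re} ∧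
      ∀ s : ℂ, 1 < s.re → LSeries (fun n => w ^ bigOmega n * χ n) s =
        H s * Complex.exp (-(e * w) * Complex.log (s - 1)) := by
  obtain ⟨e, L, he, hL, hL0, hLe⟩ := exists_regularized_LFunction χ
  set U : Set ℂ := {s | 1 < s.re} with hU
  have hcl : {s : ℂ | 1 ≤ s.re} ⊆ closure U := by
    rw [hU, Complex.closure_setOfPred_lt_re]
  have hlogc : ContinuousOn (fun s => logEuler χ s + e * Complex.log (s - 1)) U := by
    refine (continuousOn_logEuler χ).add (continuousOn_const.mul (ContinuousOn.clog (by fun_prop) ?_))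
    intro s hs
    left
    simpa using hs
  set H := fun s => Complex.exp (w * (logEuler χ s + e * Complex.log (s - 1)) + eulerDefect χ w s)
  have hE := continuousOn_eulerDefect χ hw
  have hHc : ContinuousOn H U :=
    ((continuousOn_const.mul hlogc).add (hE.mono fun s (hs : 1 < s.re) => hs.le)).cexp
  refine ⟨e, extendFrom U H, he, continuousOn_extendFrom hcl fun s hs => ?_, fun s hs => ?_⟩
  · obtain ⟨y, hy⟩ := exists_tendsto_of_exp_eq hlogc hL (fun s hs => (hLe s hs).symm) (hL0 s hs)
    have hE' := (hE s hs).mono (show U ⊆ {s | 1 ≤ s.re} from fun z (hz : 1 < z.re) => hz.le)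
    exact ⟨_, ((hy.const_mul w).add hE').cexp⟩
  · rw [LSeries_omega_eq χ hw hs, extendFrom_extends hHc s hs, ← Complex.exp_add]
    congr 1
    ring

theorem norm_exp_mul_log_le {w z : ℂ} (hw : ‖w‖ ≤ 1) (hz : z ≠ 0) :
    ‖Complex.exp (-w * Complex.log z)‖ ≤ ‖z‖ ^ (-w.re) * Real.exp Real.pi := by
  rw [Complex.norm_exp, Real.rpow_def_of_pos (norm_pos_iff.2 hz), ← Real.exp_add]
  refine Real.exp_le_exp.2 ?_
  simp only [Complex.mul_re, Complex.neg_re, Complex.neg_im, Complex.log_re, Complex.log_im]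
  have h1 : |w.im * z.arg| ≤ 1 * Real.pi := by
    rw [abs_mul]
    exact mul_le_mul ((Complex.abs_im_le_norm w).trans hw) (Complex.abs_arg_le_pi z)
      (abs_nonneg _) zero_le_one
  linarith [le_abs_self (w.im * z.arg)]

theorem integrableOn_abs_rpow {r : ℝ} (hr : -1 < r) (T : ℝ) :
    MeasureTheory.IntegrableOn (fun t : ℝ => |t| ^ r) (Set.Icc (-T) T) := by
  have h1 (T : ℝ) : MeasureTheory.IntegrableOn (fun t : ℝ => |t| ^ r) (Set.Icc 0 T) := by
    rcases lt_or_ge T 0 with hT | hT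
    · simp [Set.Icc_eq_empty (not_le.2 hT)]
    · have := (intervalIntegrable_iff_integrableOn_Icc_of_le hT).1
        (intervalIntegral.intervalIntegrable_rpow' (a := 0) (b := T) hr)
      exact this.congr_fun (fun t ht => by simp only [abs_of_nonneg ht.1]) measurableSet_Icc
  have h2 : MeasureTheory.IntegrableOn (fun t : ℝ => |t| ^ r) (Set.Icc (-T) 0) := by
    have h := ((MeasureTheory.Measure.measurePreserving_neg
      (MeasureTheory.volume : MeasureTheory.Measure ℝ)).integrableOn_comp_preimage
        (MeasurableEquiv.neg ℝ).measurableEmbedding).2 (h1 T)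
    simpa [Function.comp_def] using h
  refine (h2.union (h1 T)).mono_set fun t ht => ?_
  rcases le_total t 0 with h | h
  · exact Or.inl ⟨ht.1, h⟩
  · exact Or.inr ⟨h, ht.2⟩

theorem meanZero_omega_mul_character [NeZero q] {w : ℂ} (hw : ‖w‖ ≤ 1) (hw1 : w.re < 1) :
    MeanZero fun n => w ^ bigOmega n * χ n := by
  obtain ⟨e, H, he, hH, hF⟩ := exists_LSeries_omega_eq_mul_exp χ hw
  have hew : ‖e * w‖ ≤ 1 ∧ (e * w).re < 1 := by
    rcases he with rfl | rfl <;> simp [hw, hw1]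
  have hre (δ t : ℝ) : (1 + (δ + t * Complex.I) : ℂ).re = 1 + δ := by simp
  refine meanZero_of_LSeries (fun n => ?_) (fun T hT => ?_) fun t ht => ?_
  · rw [norm_mul, norm_pow]
    exact mul_le_one₀ (pow_le_one₀ (norm_nonneg _) hw) (norm_nonneg _) (χ.norm_le_one _)
  · have hK : IsCompact (Set.Icc (1 : ℝ) 2 ×ℂ Set.Icc (-T) T) := isCompact_Icc.reProdIm isCompact_Icc
    obtain ⟨C, hC⟩ := hK.exists_bound_of_continuousOn (hH.mono fun s hs => hs.1.1)
    set r := -(e * w).re with hr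
    refine ⟨(Set.Icc (-T) T).indicator fun t => |C| * ((|t| ^ r + (2 + T)) * Real.exp Real.pi), ?_,
      fun δ hδ t ht ht0 => ?_⟩
    · rw [MeasureTheory.integrable_indicator_iff measurableSet_Icc]
      refine (((integrableOn_abs_rpow (by linarith [hew.2]) T).add ?_).mul_const _).const_mul _
      exact MeasureTheory.integrableOn_const (by simp)
    · have htm : t ∈ Set.Icc (-T) T := abs_le.1 ht
      rw [Set.indicator_of_mem htm, hF _ (by rw [hre]; linarith [hδ.1]), add_sub_cancel_left, norm_mul]
      have hz : (δ + t * Complex.I : ℂ) ≠ 0 := fun h => ht0 (by simpa using congrArg Complex.im h)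
      gcongr
      · refine (hC _ ?_).trans (le_abs_self C)
        rw [Complex.mem_reProdIm, hre]
        exact ⟨⟨by linarith [hδ.1], by linarith [hδ.2]⟩, by simpa using htm⟩
      · refine (norm_exp_mul_log_le hew.1 hz).trans ?_
        gcongr
        rw [← hr]
        have h1 : |t| ≤ ‖(δ + t * Complex.I : ℂ)‖ := by
          simpa using Complex.abs_im_le_norm (δ + t * Complex.I : ℂ)
        have h2 : ‖(δ + t * Complex.I : ℂ)‖ ≤ 2 + T := by
          refine (norm_add_le _ _).trans ?_
          simp only [norm_mul, Complex.norm_real, Complex.norm_I, mul_one, Real.norm_eq_abs]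
          rw [abs_of_pos hδ.1]
          linarith [hδ.2]
        have ht' : 0 < |t| := abs_pos.2 ht0
        rcases le_total r 0 with h | h
        · have := Real.rpow_le_rpow_of_nonpos ht' h1 h
          linarith
        · have h3 : ‖(δ + t * Complex.I : ℂ)‖ ^ r ≤ (2 + T) ^ r := Real.rpow_le_rpow (norm_nonneg _) h2 h
          have hr1 : r ≤ 1 := by
            have := Complex.abs_re_le_norm (e * w)
            rw [hr]
            linarith [neg_abs_le (e * w).re, hew.1]
          have h4 : (2 + T) ^ r ≤ (2 + T) ^ (1 : ℝ) :=
            Real.rpow_le_rpow_of_exponent_le (by linarith) hr1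
          rw [Real.rpow_one] at h4
          have : 0 ≤ |t| ^ r := by positivity
          linarith
  · have hd : Tendsto (fun δ : ℝ => (1 + (δ + t * Complex.I) : ℂ)) (𝓝[>] 0)
        (𝓝 (1 + ((0 : ℝ) + t * Complex.I))) :=
      (Continuous.tendsto (f := fun δ : ℝ => (1 + (δ + t * Complex.I) : ℂ)) (by fun_prop) 0).mono_left
        nhdsWithin_le_nhds
    have hpos : ∀ᶠ δ : ℝ in 𝓝[>] 0, 0 < δ := self_mem_nhdsWithin
    have hd' : Tendsto (fun δ : ℝ => (1 + (δ + t * Complex.I) : ℂ)) (𝓝[>] 0)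
        (𝓝[{s | 1 ≤ s.re}] (1 + ((0 : ℝ) + t * Complex.I))) :=
      tendsto_nhdsWithin_iff.2 ⟨hd, hpos.mono fun δ hδ => by
        rw [Set.mem_ofPred, hre]; linarith⟩
    have h1 := (hH (1 + ((0 : ℝ) + t * Complex.I)) (by
      rw [Set.mem_ofPred, hre]; simp)).tendsto.comp hd'
    have h2 := (((hd.sub_const 1).clog (by
      right
      simpa using ht)).const_mul (-(e * w))).cexp
    refine ⟨_, (h1.mul h2).congr' (hpos.mono fun δ hδ => ?_)⟩
    exact (hF _ (by rw [hre]; linarith)).symm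
end DirichletTwist

section MeanZeroLemmas
variable {a b : ℕ → ℂ}

theorem MeanZero.const_mul (ha : MeanZero a) (c : ℂ) : MeanZero fun n => c * a n := by
  have := Tendsto.const_mul c ha
  simpa [MeanZero, ← Finset.mul_sum, mul_div_assoc] using this

theorem MeanZero.add (ha : MeanZero a) (hb : MeanZero b) : MeanZero fun n => a n + b n := by
  have := Tendsto.add ha hb
  simpa [MeanZero, Finset.sum_add_distrib, add_div] using this

theorem MeanZero.sub (ha : MeanZero a) (hb : MeanZero b) : MeanZero fun n => a n - b n := by
  simpa [sub_eq_add_neg] using ha.add (hb.const_mul (-1))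

theorem MeanZero.sum {ι : Type*} {s : Finset ι} {A : ι → ℕ → ℂ} (h : ∀ i ∈ s, MeanZero (A i)) :
    MeanZero fun n => ∑ i ∈ s, A i n := by
  have := tendsto_finsetSum s h
  simp only [Finset.sum_const_zero] at this
  refine this.congr fun N => ?_
  rw [← Finset.sum_div, Finset.sum_comm]

theorem meanZero_of_approx
    (h : ∀ ε > (0 : ℝ), ∃ b, MeanZero b ∧
      ∀ᶠ N : ℕ in atTop, ‖∑ n ∈ Finset.Icc 1 N, (a n - b n)‖ ≤ ε * N) : MeanZero a := by
  rw [MeanZero, NormedAddGroup.tendsto_nhds_zero]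
  intro ε hε
  obtain ⟨b, hb, hab⟩ := h (ε / 2) (by positivity)
  rw [MeanZero, NormedAddGroup.tendsto_nhds_zero] at hb
  filter_upwards [hab, hb (ε / 2) (by positivity), eventually_gt_atTop 0] with N h1 h2 h3
  have hN : (0 : ℝ) < N := by exact_mod_cast h3
  rw [norm_div, Complex.norm_natCast, div_lt_iff₀ hN] at h2 ⊢
  rw [Finset.sum_sub_distrib] at h1
  linarith [norm_le_norm_sub_add (∑ n ∈ Finset.Icc 1 N, a n) (∑ n ∈ Finset.Icc 1 N, b n)]

theorem MeanZero.tendsto_comp (ha : MeanZero a) {M : ℕ → ℕ} (hM : Tendsto M atTop atTop) {C : ℝ}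
    (hC : ∀ᶠ N : ℕ in atTop, (M N : ℝ) ≤ C * N) :
    Tendsto (fun N : ℕ => (∑ n ∈ Finset.Icc 1 (M N), a n) / (N : ℂ)) atTop (𝓝 0) := by
  have h1 := (ha.comp hM).zero_mul_isBoundedUnder_le (g := fun N : ℕ => (M N / N : ℂ))
    (isBoundedUnder_of_eventually_le (a := C) ?_)
  · refine h1.congr' ?_
    filter_upwards [hM.eventually_gt_atTop 0] with N hN
    have : (M N : ℂ) ≠ 0 := by exact_mod_cast hN.ne'
    simp only [Function.comp]
    rw [div_mul_div_comm, mul_comm _ (M N : ℂ), mul_div_mul_left _ _ this]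
  · filter_upwards [hC, eventually_gt_atTop 0] with N h h0
    have hN : (0 : ℝ) < N := by exact_mod_cast h0
    simpa [div_le_iff₀ hN] using h

end MeanZeroLemmas

theorem sum_Icc_eq_sum_multiples {d : ℕ} (hd : 0 < d) (F : ℕ → ℂ) (hF : ∀ n, ¬ d ∣ n → F n = 0)
    (N : ℕ) : ∑ n ∈ Finset.Icc 1 N, F n = ∑ m ∈ Finset.Icc 1 (N / d), F (d * m) := by
  have hinj : Set.InjOn (fun m => d * m) (Finset.Icc 1 (N / d) : Set ℕ) :=
    fun x _ y _ h => Nat.eq_of_mul_eq_mul_left hd h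
  rw [← Finset.sum_image hinj]
  symm
  refine Finset.sum_subset (fun n hn => ?_) fun n hn hn' => hF n fun ⟨m, hm⟩ => hn' ?_
  · obtain ⟨m, hm, rfl⟩ := Finset.mem_image.1 hn
    rw [Finset.mem_Icc, Nat.le_div_iff_mul_le hd] at hm
    rw [Finset.mem_Icc, mul_comm d]
    exact ⟨Nat.mul_pos (by omega) hd, hm.2⟩
  · rw [Finset.mem_Icc, hm] at hn
    rw [Finset.mem_image]
    refine ⟨m, ?_, hm.symm⟩
    rw [Finset.mem_Icc, Nat.le_div_iff_mul_le hd, mul_comm m]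
    exact ⟨Nat.pos_of_mul_pos_left hn.1, hn.2⟩

section Progressions
variable {w : ℂ}

theorem meanZero_omega_progression_of_coprime (hw : ‖w‖ ≤ 1) (hw1 : w.re < 1) {q : ℕ} (hq : 0 < q)
    {r : ℕ} (hr : r.Coprime q) :
    MeanZero fun n => if n ≡ r [MOD q] then w ^ bigOmega n else 0 := by
  have : NeZero q := ⟨hq.ne'⟩
  have hu : IsUnit (r : ZMod q) := (ZMod.isUnit_iff_coprime r q).2 hr
  have h := MeanZero.const_mul (MeanZero.sum (s := Finset.univ) fun (χ : DirichletCharacter ℂ q) _ =>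
    (meanZero_omega_mul_character χ hw hw1).const_mul (χ (r : ZMod q)⁻¹)) (q.totient : ℂ)⁻¹
  convert h using 2 with n
  have h2 := DirichletCharacter.sum_char_inv_mul_char_eq ℂ hu (n : ZMod q)
  have h3 : ∑ χ : DirichletCharacter ℂ q, χ (r : ZMod q)⁻¹ * (w ^ bigOmega n * χ n) =
      w ^ bigOmega n * ∑ χ : DirichletCharacter ℂ q, χ (r : ZMod q)⁻¹ * χ n := by
    rw [Finset.mul_sum]
    exact Finset.sum_congr rfl fun χ _ => by ring
  have h4 : ((r : ZMod q) = n) ↔ n ≡ r [MOD q] := by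
    rw [eq_comm, ZMod.natCast_eq_natCast_iff]
  have h5 : (q.totient : ℂ) ≠ 0 := by exact_mod_cast (Nat.totient_pos.2 hq).ne'
  rw [h3, h2, if_congr h4 rfl rfl]
  split_ifs
  · field_simp
  · simp

theorem tendsto_nat_div_atTop {d : ℕ} (hd : 0 < d) : Tendsto (fun N : ℕ => N / d) atTop atTop :=
  tendsto_atTop.2 fun b => by
    filter_upwards [eventually_ge_atTop (b * d)] with N hN
    exact (Nat.le_div_iff_mul_le hd).2 hN

theorem meanZero_omega_progression (hw : ‖w‖ ≤ 1) (hw1 : w.re < 1) {q : ℕ} (hq : 0 < q) (r : ℕ) :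
    MeanZero fun n => if n ≡ r [MOD q] then w ^ bigOmega n else 0 := by
  obtain ⟨d, r', q', hd, hco, hr, hq'⟩ := Nat.exists_coprime' (m := r) (n := q) (Nat.gcd_pos_of_pos_right r hq)
  have hq'0 : 0 < q' := Nat.pos_of_ne_zero fun h => by simp [h] at hq'; omega
  have h1 := ((meanZero_omega_progression_of_coprime hw hw1 hq'0 hco).const_mul
    (w ^ bigOmega d)).tendsto_comp (tendsto_nat_div_atTop hd) (C := 1) (.of_forall fun N => by
      rw [one_mul]; exact_mod_cast Nat.div_le_self N d)
  refine h1.congr fun N => ?_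
  rw [sum_Icc_eq_sum_multiples hd (fun n => if n ≡ r [MOD q] then w ^ bigOmega n else 0)]
  · congr 1
    refine Finset.sum_congr rfl fun m hm => ?_
    have hm0 : m ≠ 0 := by have := (Finset.mem_Icc.1 hm).1; omega
    have hiff : d * m ≡ r [MOD q] ↔ m ≡ r' [MOD q'] := by
      rw [hr, hq', mul_comm r', mul_comm q']
      exact Nat.ModEq.mul_left_cancel_iff' hd.ne'
    rw [if_congr hiff rfl rfl, bigOmega_mul hd.ne' hm0, pow_add, mul_ite, mul_zero]
  · intro n hn
    refine if_neg fun h => hn ?_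
    have hdq : d ∣ q := hq' ▸ Dvd.intro_left _ rfl
    have hdr : d ∣ r := hr ▸ Dvd.intro_left _ rfl
    exact ((h.of_dvd hdq).dvd_iff dvd_rfl).2 hdr

theorem meanZero_omega (hw : ‖w‖ ≤ 1) (hw1 : w.re < 1) : MeanZero fun n => w ^ bigOmega n := by
  simpa [Nat.modEq_one] using meanZero_omega_progression hw hw1 one_pos 0

theorem meanZero_omega_mul_periodic (hw : ‖w‖ ≤ 1) (hw1 : w.re < 1) {q : ℕ} (hq : 0 < q)
    {c : ℕ → ℂ} (hc : c.Periodic q) : MeanZero fun n => w ^ bigOmega n * c n := by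
  have h := MeanZero.sum (s := Finset.range q) fun r _ =>
    (meanZero_omega_progression hw hw1 hq r).const_mul (c r)
  convert h using 2 with n
  rw [Finset.sum_eq_single (n % q)]
  · rw [if_pos (Nat.mod_modEq n q).symm, hc.map_mod_nat, mul_comm]
  · intro r hr hne
    rw [if_neg, mul_zero]
    intro h
    have h2 : n % q = r % q := h
    rw [Nat.mod_eq_of_lt (Finset.mem_range.1 hr)] at h2
    exact hne h2.symm
  · intro h
    exact absurd (Finset.mem_range.2 (Nat.mod_lt n hq)) h

end Progressions

section DaboussiKatai
variable {P : Finset ℕ} {N : ℕ}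

theorem card_filter_dvd_Icc (N d : ℕ) :
    ∑ n ∈ Finset.Icc 1 N, (if d ∣ n then (1 : ℝ) else 0) = (N / d : ℕ) := by
  rw [Finset.sum_boole, ← Nat.Ioc_filter_dvd_card_eq_div]
  rfl

/-- A Turán–Kubilius inequality for the number of prime divisors in a finite set of primes. -/
theorem sum_sq_card_primeDivisors_sub_le (hP : ∀ p ∈ P, p.Prime) (N : ℕ) :
    ∑ n ∈ Finset.Icc 1 N,
      ((∑ p ∈ P, if p ∣ n then (1 : ℝ) else 0) - ∑ p ∈ P, (1 / p : ℝ)) ^ 2 ≤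
      N * (∑ p ∈ P, (1 / p : ℝ)) + 2 * (∑ p ∈ P, (1 / p : ℝ)) * P.card := by
  set A := ∑ p ∈ P, (1 / p : ℝ) with hA
  have hA0 : 0 ≤ A := Finset.sum_nonneg fun p _ => by positivity
  have h1 : N * A - P.card ≤ ∑ n ∈ Finset.Icc 1 N, ∑ p ∈ P, if p ∣ n then (1 : ℝ) else 0 := by
    rw [Finset.sum_comm, hA, Finset.mul_sum, Finset.card_eq_sum_ones, Nat.cast_sum,
      ← Finset.sum_sub_distrib]
    refine Finset.sum_le_sum fun p hp => ?_
    rw [card_filter_dvd_Icc, ← Nat.floor_div_eq_div (K := ℝ)]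
    have := Nat.lt_floor_add_one ((N : ℝ) / p)
    rw [mul_one_div, Nat.cast_one]
    linarith
  have h2 : ∑ n ∈ Finset.Icc 1 N, (∑ p ∈ P, if p ∣ n then (1 : ℝ) else 0) ^ 2 ≤
      N * A ^ 2 + N * A := by
    have hpq : ∀ p ∈ P, ∀ q ∈ P, ∑ n ∈ Finset.Icc 1 N,
        ((if p ∣ n then (1 : ℝ) else 0) * if q ∣ n then (1 : ℝ) else 0) ≤
        N * (1 / p * (1 / q)) + if p = q then N * (1 / p : ℝ) else 0 := by
      intro p hp q hq
      rcases eq_or_ne p q with rfl | hne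
      · have : ∀ n, ((if p ∣ n then (1 : ℝ) else 0) * if p ∣ n then (1 : ℝ) else 0) =
            if p ∣ n then (1 : ℝ) else 0 := fun n => by split_ifs <;> simp
        simp only [this, card_filter_dvd_Icc, if_true]
        have h3 : ((N / p : ℕ) : ℝ) ≤ N / p := Nat.cast_div_le
        have h4 : (0 : ℝ) ≤ N * (1 / p * (1 / p)) := by positivity
        rw [← mul_one_div] at h3
        linarith
      · have hco : p.Coprime q := (Nat.coprime_primes (hP p hp) (hP q hq)).2 hne
        have : ∀ n, ((if p ∣ n then (1 : ℝ) else 0) * if q ∣ n then (1 : ℝ) else 0) =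
            if p * q ∣ n then (1 : ℝ) else 0 := fun n => by
          rw [ite_zero_mul_ite_zero, one_mul]
          exact if_congr ⟨fun h => hco.mul_dvd_of_dvd_of_dvd h.1 h.2,
            fun h => ⟨dvd_of_mul_right_dvd h, dvd_of_mul_left_dvd h⟩⟩ rfl rfl
        simp only [this, card_filter_dvd_Icc, if_neg hne, add_zero]
        have h3 : ((N / (p * q) : ℕ) : ℝ) ≤ N / (p * q : ℕ) := Nat.cast_div_le
        refine h3.trans (le_of_eq ?_)
        push_cast
        ring
    simp only [sq, Finset.sum_mul_sum]
    rw [Finset.sum_comm]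
    have h5 : N * (A * A) + N * A =
        ∑ p ∈ P, ∑ q ∈ P, (N * (1 / p * (1 / q)) + if p = q then N * (1 / p : ℝ) else 0) := by
      simp only [Finset.sum_add_distrib, Finset.sum_ite_eq]
      rw [hA, Finset.sum_mul_sum, Finset.mul_sum, Finset.mul_sum]
      congr 1
      · exact Finset.sum_congr rfl fun p _ => by rw [Finset.mul_sum]
      · exact Finset.sum_congr rfl fun p hp => by rw [if_pos hp]
    rw [h5]
    refine Finset.sum_le_sum fun p hp => ?_
    rw [Finset.sum_comm]
    exact Finset.sum_le_sum fun q hq => hpq p hp q hq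
  have h6 : ∀ n, ((∑ p ∈ P, if p ∣ n then (1 : ℝ) else 0) - A) ^ 2 =
      (∑ p ∈ P, if p ∣ n then (1 : ℝ) else 0) ^ 2 -
        2 * A * (∑ p ∈ P, if p ∣ n then (1 : ℝ) else 0) + A ^ 2 := fun n => by ring
  simp only [h6]
  rw [Finset.sum_add_distrib, Finset.sum_sub_distrib, ← Finset.mul_sum, Finset.sum_const,
    Nat.card_Icc, nsmul_eq_mul, Nat.add_sub_cancel]
  nlinarith [mul_le_mul_of_nonneg_left h1 hA0]

theorem norm_sum_mul_sq_le {g D : ℕ → ℂ} (hg : ∀ n, ‖g n‖ ≤ 1) (N : ℕ) :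
    ‖∑ n ∈ Finset.Icc 1 N, g n * D n‖ ^ 2 ≤ N * ∑ n ∈ Finset.Icc 1 N, ‖D n‖ ^ 2 := by
  have h1 : ‖∑ n ∈ Finset.Icc 1 N, g n * D n‖ ≤ ∑ n ∈ Finset.Icc 1 N, ‖D n‖ :=
    norm_sum_le_of_le _ fun n _ => by
      rw [norm_mul]
      exact mul_le_of_le_one_left (norm_nonneg _) (hg n)
  calc _ ≤ (∑ n ∈ Finset.Icc 1 N, ‖D n‖) ^ 2 := by gcongr
    _ ≤ _ := by simpa using sq_sum_le_card_mul_sum_sq (s := Finset.Icc 1 N) (f := fun n => ‖D n‖)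

theorem norm_geom_sum_Icc_le {u : ℂ} (hu : ‖u‖ = 1) (hu1 : u ≠ 1) (M : ℕ) :
    ‖∑ m ∈ Finset.Icc 1 M, u ^ m‖ ≤ 2 / ‖u - 1‖ := by
  have h : ∑ m ∈ Finset.Icc 1 M, u ^ m = (u ^ (M + 1) - u ^ 1) / (u - 1) := by
    rw [← geom_sum_Ico hu1 (by omega)]
    rfl
  rw [h, norm_div]
  gcongr
  refine (norm_sub_le _ _).trans ?_
  simp only [norm_pow, hu, one_pow]
  norm_num

theorem exists_sum_sq_norm_le {z : ℂ} (hz : ‖z‖ = 1) (hz1 : ∀ n : ℕ, 0 < n → z ^ n ≠ 1)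
    (hP : ∀ p ∈ P, 0 < p) : ∃ B : ℝ, ∀ N : ℕ,
      ∑ m ∈ Finset.Icc 1 N, ‖∑ p ∈ P, if p * m ≤ N then z ^ (p * m) else 0‖ ^ 2 ≤
        N * (∑ p ∈ P, (1 / p : ℝ)) + B := by
  set u : ℕ → ℕ → ℂ := fun p q => z ^ p * (starRingEnd ℂ) (z ^ q) with hu
  have hzz : z * (starRingEnd ℂ) z = 1 := by
    rw [Complex.mul_conj, Complex.normSq_eq_norm_sq, hz]
    simp
  have hu1 : ∀ p q, ‖u p q‖ = 1 := fun p q => by simp [hu, hz]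
  have hne : ∀ p q, p < q → z ^ p ≠ z ^ q := fun p q hpq h => by
    refine hz1 (q - p) (by omega) ?_
    have hzp : z ^ p ≠ 0 := pow_ne_zero _ fun h => by simp [h] at hz
    refine mul_left_cancel₀ hzp ?_
    rw [← pow_add, mul_one, h]
    congr 1
    omega
  have hu2 : ∀ p q, p ≠ q → u p q ≠ 1 := fun p q hpq h => by
    have h2 : z ^ p = z ^ q := by
      calc z ^ p = u p q * z ^ q := by
            simp only [hu]
            rw [map_pow, mul_assoc, ← mul_pow, mul_comm _ z, hzz, one_pow, mul_one]
        _ = z ^ q := by rw [h, one_mul]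
    rcases lt_or_gt_of_ne hpq with h3 | h3
    · exact hne p q h3 h2
    · exact hne q p h3 h2.symm
  refine ⟨∑ p ∈ P, ∑ q ∈ P, if p = q then 0 else 2 / ‖u p q - 1‖, fun N => ?_⟩
  have hsum : ((∑ m ∈ Finset.Icc 1 N,
      ‖∑ p ∈ P, if p * m ≤ N then z ^ (p * m) else 0‖ ^ 2 : ℝ) : ℂ) =
      ∑ p ∈ P, ∑ q ∈ P, ∑ m ∈ Finset.Icc 1 (min (N / p) (N / q)), u p q ^ m := by
    push_cast
    simp only [← Complex.mul_conj', map_sum, Finset.sum_mul_sum]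
    rw [Finset.sum_comm]
    refine Finset.sum_congr rfl fun p hp => ?_
    rw [Finset.sum_comm]
    refine Finset.sum_congr rfl fun q hq => ?_
    symm
    refine Finset.sum_subset_zero_on_sdiff (fun m hm => ?_) (fun m hm => ?_) fun m hm => ?_
    · rw [Finset.mem_Icc, le_min_iff] at hm
      exact Finset.mem_Icc.2 ⟨hm.1, hm.2.1.trans (Nat.div_le_self _ _)⟩
    · rw [Finset.mem_sdiff, Finset.mem_Icc, Finset.mem_Icc, le_min_iff,
        Nat.le_div_iff_mul_le (hP p hp), Nat.le_div_iff_mul_le (hP q hq), mul_comm m p,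
        mul_comm m q] at hm
      by_cases h1 : p * m ≤ N
      · rw [if_neg (c := q * m ≤ N) fun h2 => hm.2 ⟨hm.1.1, h1, h2⟩, map_zero, mul_zero]
      · rw [if_neg h1, zero_mul]
    · rw [Finset.mem_Icc, le_min_iff,
        Nat.le_div_iff_mul_le (hP p hp), Nat.le_div_iff_mul_le (hP q hq), mul_comm m p,
        mul_comm m q] at hm
      rw [if_pos hm.2.1, if_pos hm.2.2, hu, mul_pow, ← map_pow, ← pow_mul, ← pow_mul]
  have hnorm := congrArg norm hsum
  rw [Complex.norm_of_nonneg (Finset.sum_nonneg fun _ _ => sq_nonneg _)] at hnorm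
  rw [hnorm, Finset.mul_sum, ← Finset.sum_add_distrib]
  refine norm_sum_le_of_le _ fun p hp => ?_
  have hsplit : (N * (1 / p : ℝ)) + ∑ q ∈ P, (if p = q then 0 else 2 / ‖u p q - 1‖) =
      ∑ q ∈ P, if p = q then (N * (1 / p : ℝ)) else 2 / ‖u p q - 1‖ := by
    have h1 : (N * (1 / p : ℝ)) = ∑ q ∈ P, if p = q then (N * (1 / p : ℝ)) else 0 := by
      rw [Finset.sum_ite_eq, if_pos hp]
    conv_lhs => rw [h1]
    rw [← Finset.sum_add_distrib]
    exact Finset.sum_congr rfl fun q _ => by split_ifs <;> simp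
  rw [hsplit]
  refine norm_sum_le_of_le _ fun q hq => ?_
  split_ifs with h
  · subst h
    refine (norm_sum_le_of_le (f := fun m => u p p ^ m) _ fun m _ =>
      (by rw [norm_pow, hu1, one_pow] : ‖u p p ^ m‖ ≤ 1)).trans ?_
    simpa [div_eq_mul_inv] using (Nat.cast_div_le : ((N / p : ℕ) : ℝ) ≤ N / p)
  · exact norm_geom_sum_Icc_le (hu1 p q) (hu2 p q h) _

theorem exists_prime_finset_le_sum_one_div (C : ℝ) :
    ∃ P : Finset ℕ, (∀ p ∈ P, p.Prime) ∧ C ≤ ∑ p ∈ P, (1 / p : ℝ) := by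
  by_contra! h
  refine Nat.Primes.not_summable_one_div (summable_of_sum_le (c := C) (fun p => by positivity)
    fun P => ?_)
  have := h (P.map ⟨fun p : Nat.Primes => (p : ℕ), Subtype.val_injective⟩) fun p hp => by
    obtain ⟨q, _, rfl⟩ := Finset.mem_map.1 hp
    exact q.2
  rw [Finset.sum_map] at this
  exact this.le

/-- Daboussi's theorem for the completely multiplicative function `w ^ bigOmega n`. -/
theorem meanZero_omega_mul_pow {w z : ℂ} (hw : ‖w‖ ≤ 1) (hz : ‖z‖ = 1)
    (hz1 : ∀ n : ℕ, 0 < n → z ^ n ≠ 1) : MeanZero fun n => w ^ bigOmega n * z ^ n := by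
  refine meanZero_of_approx fun ε hε => ⟨fun _ => 0, by simp [MeanZero], ?_⟩
  obtain ⟨P, hP, hA⟩ := exists_prime_finset_le_sum_one_div (8 / ε ^ 2)
  obtain ⟨B, hB⟩ := exists_sum_sq_norm_le hz hz1 fun p hp => (hP p hp).pos
  have hTK := sum_sq_card_primeDivisors_sub_le hP
  set A := ∑ p ∈ P, (1 / p : ℝ)
  have hA0 : 0 < A := lt_of_lt_of_le (by positivity) hA
  have hlarge : ∀ K : ℝ, ∀ᶠ N : ℕ in atTop, K ≤ N * A := fun K =>
    ((tendsto_natCast_atTop_atTop (R := ℝ)).atTop_mul_const hA0).eventually_ge_atTop K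
  have hf : ∀ n, ‖w ^ bigOmega n‖ ≤ 1 := fun n => by
    rw [norm_pow]
    exact pow_le_one₀ (norm_nonneg _) hw
  filter_upwards [hlarge B, hlarge (2 * A * P.card)] with N hN1 hN2
  set g : ℕ → ℂ := fun n => w ^ bigOmega n * z ^ n with hg_def
  have hg : ∀ n, ‖g n‖ ≤ 1 := fun n => by
    simpa [hg_def, hz] using hf n
  set c : ℕ → ℝ := fun n => ∑ p ∈ P, if p ∣ n then (1 : ℝ) else 0 with hc
  set S := ∑ n ∈ Finset.Icc 1 N, g n
  have hX : ‖∑ n ∈ Finset.Icc 1 N, g n * ((c n - A : ℝ) : ℂ)‖ ^ 2 ≤ 2 * A * N ^ 2 := by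
    refine (norm_sum_mul_sq_le hg N).trans ?_
    simp only [Complex.norm_real, Real.norm_eq_abs, sq_abs]
    have := mul_le_mul_of_nonneg_left (hTK N) (Nat.cast_nonneg (α := ℝ) N)
    nlinarith
  have hcg : ∑ n ∈ Finset.Icc 1 N, g n * (c n : ℂ) =
      w * ∑ m ∈ Finset.Icc 1 N, w ^ bigOmega m *
        ∑ p ∈ P, if p * m ≤ N then z ^ (p * m) else 0 := by
    simp only [hc, Complex.ofReal_sum, Finset.mul_sum]
    rw [Finset.sum_comm]
    conv_rhs => rw [Finset.sum_comm]
    refine Finset.sum_congr rfl fun p hp => ?_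
    rw [sum_Icc_eq_sum_multiples (hP p hp).pos _ fun n hn => by simp [hn]]
    refine Finset.sum_subset_zero_on_sdiff (fun m hm => ?_) (fun m hm => ?_) fun m hm => ?_
    · rw [Finset.mem_Icc] at hm ⊢
      exact ⟨hm.1, hm.2.trans (Nat.div_le_self _ _)⟩
    · rw [Finset.mem_sdiff, Finset.mem_Icc, Finset.mem_Icc,
        Nat.le_div_iff_mul_le (hP p hp).pos, mul_comm m p] at hm
      rw [if_neg fun h => hm.2 ⟨hm.1.1, h⟩, mul_zero, mul_zero]
    · rw [Finset.mem_Icc, Nat.le_div_iff_mul_le (hP p hp).pos, mul_comm m p] at hm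
      rw [if_pos hm.2, if_pos (dvd_mul_right p m), hg_def]
      simp only
      rw [bigOmega_mul (hP p hp).ne_zero (by omega), bigOmega_prime (hP p hp)]
      push_cast
      ring
  have hY : ‖∑ n ∈ Finset.Icc 1 N, g n * (c n : ℂ)‖ ^ 2 ≤ 2 * A * N ^ 2 := by
    rw [hcg, norm_mul, mul_pow]
    refine (mul_le_of_le_one_left (sq_nonneg _) (pow_le_one₀ (norm_nonneg _) hw)).trans ?_
    refine (norm_sum_mul_sq_le hf N).trans ?_
    have := mul_le_mul_of_nonneg_left (hB N) (Nat.cast_nonneg (α := ℝ) N)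
    nlinarith
  have hS : (A : ℂ) * S = (∑ n ∈ Finset.Icc 1 N, g n * (c n : ℂ)) -
      ∑ n ∈ Finset.Icc 1 N, g n * ((c n - A : ℝ) : ℂ) := by
    rw [← Finset.sum_sub_distrib, Finset.mul_sum]
    refine Finset.sum_congr rfl fun n _ => ?_
    push_cast
    ring
  have hS2 : A * ‖S‖ ≤ ‖∑ n ∈ Finset.Icc 1 N, g n * (c n : ℂ)‖ +
      ‖∑ n ∈ Finset.Icc 1 N, g n * ((c n - A : ℝ) : ℂ)‖ := by
    have := norm_sub_le (∑ n ∈ Finset.Icc 1 N, g n * (c n : ℂ))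
      (∑ n ∈ Finset.Icc 1 N, g n * ((c n - A : ℝ) : ℂ))
    rwa [← hS, norm_mul, Complex.norm_of_nonneg hA0.le] at this
  simp only [sub_zero]
  have hS3 : (A * ‖S‖) ^ 2 ≤ A * (8 * N ^ 2) := by
    refine (pow_le_pow_left₀ (by positivity) hS2 2).trans ?_
    refine add_sq_le.trans ?_
    linarith
  have hS4 : A * ‖S‖ ^ 2 ≤ 8 * N ^ 2 := by
    rw [mul_pow, sq A, mul_assoc] at hS3
    exact le_of_mul_le_mul_left hS3 hA0
  have hA8 : 8 ≤ A * ε ^ 2 := by rwa [div_le_iff₀ (by positivity)] at hA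
  refine (pow_le_pow_iff_left₀ (norm_nonneg _) (by positivity) two_ne_zero).1 ?_
  have : A * ‖S‖ ^ 2 ≤ A * (ε * N) ^ 2 := by
    refine hS4.trans ?_
    rw [mul_pow, ← mul_assoc]
    gcongr
  exact le_of_mul_le_mul_left this hA0

end DaboussiKatai

section Circle
open AddCircle MeasureTheory

theorem meanZero_mul_comp_sub_integral {f : ℕ → ℂ} (hf : ∀ n, ‖f n‖ ≤ 1) {c : ℂ}
    {x : ℕ → UnitAddCircle}
    (h : ∀ k : ℤ, MeanZero fun n =>
      f n * fourier k (x n) - c * ∫ t : UnitAddCircle, fourier k t ∂haarAddCircle)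
    (H : C(UnitAddCircle, ℂ)) :
    MeanZero fun n => f n * H (x n) - c * ∫ t : UnitAddCircle, H t ∂haarAddCircle := by
  have hint : ∀ G : C(UnitAddCircle, ℂ), Integrable (fun t => G t) (haarAddCircle (T := 1)) :=
    fun G => G.continuous.integrable_of_hasCompactSupport (HasCompactSupport.of_compactSpace _)
  have hspan : ∀ G ∈ Submodule.span ℂ (Set.range (@fourier 1)),
      MeanZero fun n => f n * G (x n) - c * ∫ t : UnitAddCircle, G t ∂haarAddCircle := by
    intro G hG
    induction hG using Submodule.span_induction with
    | mem G hG =>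
      obtain ⟨k, rfl⟩ := hG
      exact h k
    | zero => simp [MeanZero]
    | add G₁ G₂ _ _ h1 h2 =>
      convert h1.add h2 using 2 with n
      simp only [ContinuousMap.add_apply]
      rw [integral_add (hint G₁) (hint G₂)]
      ring
    | smul a G _ h1 =>
      convert h1.const_mul a using 2 with n
      simp only [ContinuousMap.smul_apply, smul_eq_mul]
      rw [integral_const_mul]
      ring
  refine meanZero_of_approx fun ε hε => ?_
  have hH : H ∈ closure (Submodule.span ℂ (Set.range (@fourier 1)) : Set C(UnitAddCircle, ℂ)) := by
    rw [← Submodule.topologicalClosure_coe, span_fourier_closure_eq_top]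
    trivial
  obtain ⟨G, hG, hGH⟩ := Metric.mem_closure_iff.1 hH (ε / (1 + ‖c‖)) (by positivity)
  refine ⟨_, hspan G hG, .of_forall fun N => ?_⟩
  rw [dist_eq_norm] at hGH
  have hc : ‖H - G‖ * (1 + ‖c‖) ≤ ε := ((lt_div_iff₀ (by positivity)).1 hGH).le
  have hn : ∀ n, ‖f n * H (x n) - c * ∫ t : UnitAddCircle, H t ∂haarAddCircle -
      (f n * G (x n) - c * ∫ t : UnitAddCircle, G t ∂haarAddCircle)‖ ≤ ε := by
    intro n
    have h1 : f n * H (x n) - c * ∫ t : UnitAddCircle, H t ∂haarAddCircle -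
        (f n * G (x n) - c * ∫ t : UnitAddCircle, G t ∂haarAddCircle) =
        f n * (H - G) (x n) - c * ∫ t : UnitAddCircle, (H - G) t ∂haarAddCircle := by
      simp only [ContinuousMap.sub_apply]
      rw [integral_sub (hint H) (hint G)]
      ring
    have h2 : ‖∫ t : UnitAddCircle, (H - G) t ∂haarAddCircle‖ ≤ ‖H - G‖ := by
      simpa using norm_integral_le_of_norm_le_const (μ := haarAddCircle (T := 1))
        (.of_forall fun t => (H - G).norm_coe_le_norm t)
    rw [h1]
    refine (norm_sub_le _ _).trans (le_trans ?_ hc)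
    rw [norm_mul, norm_mul, mul_add, mul_one, mul_comm ‖c‖]
    exact add_le_add ((mul_le_of_le_one_left (norm_nonneg _) (hf n)).trans
      ((H - G).norm_coe_le_norm _)) (mul_le_mul_of_nonneg_right h2 (norm_nonneg _))
  refine (norm_sum_le_of_le _ fun n _ => hn n).trans ?_
  simp [mul_comm]

theorem integral_fourier {k : ℤ} (hk : k ≠ 0) :
    ∫ t : UnitAddCircle, fourier k t ∂haarAddCircle = 0 :=
  integral_eq_zero_of_add_right_eq_neg (μ := haarAddCircle)
    (fourier_add_half_inv_index hk zero_lt_one)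

variable {w : ℂ} {θ : ℝ}

theorem exp_pow_ne_one_of_irrational (hθ : Irrational θ) {k : ℤ} (hk : k ≠ 0) {n : ℕ}
    (hn : 0 < n) : Complex.exp (2 * Real.pi * Complex.I * k * θ) ^ n ≠ 1 := by
  rw [← Complex.exp_nat_mul, Ne, Complex.exp_eq_one_iff]
  rintro ⟨m, hm⟩
  have h1 : (((n * k : ℤ) : ℝ) * θ : ℂ) = ((m : ℝ) : ℂ) := by
    have h2 : (2 * Real.pi * Complex.I : ℂ) ≠ 0 := Complex.two_pi_I_ne_zero
    refine mul_left_cancel₀ h2 ?_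
    push_cast
    linear_combination hm
  have h3 : ((n * k : ℤ) : ℝ) * θ = ((m : ℤ) : ℝ) := by exact_mod_cast h1
  have h4 : (n * k : ℤ) ≠ 0 := mul_ne_zero (by omega) hk
  exact (hθ.intCast_mul h4).ne_int m h3

theorem meanZero_omega_mul_fourier (hw : ‖w‖ ≤ 1) (hθ : Irrational θ) (s : ℝ) {k : ℤ}
    (hk : k ≠ 0) :
    MeanZero fun n => w ^ bigOmega n * fourier k ((n * θ + s : ℝ) : UnitAddCircle) := by
  have h := (meanZero_omega_mul_pow (z := Complex.exp (2 * Real.pi * Complex.I * k * θ)) hw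
    (by rw [Complex.norm_exp]; simp) fun n hn => exp_pow_ne_one_of_irrational hθ hk hn).const_mul
      (Complex.exp (2 * Real.pi * Complex.I * k * s))
  convert h using 2 with n
  rw [fourier_coe_apply, ← Complex.exp_nat_mul, mul_left_comm, ← Complex.exp_add]
  congr 2
  push_cast
  ring

theorem meanZero_omega_mul_continuous (hw : ‖w‖ ≤ 1) (hw1 : w.re < 1) (hθ : Irrational θ) (s : ℝ)
    (H : C(UnitAddCircle, ℂ)) :
    MeanZero fun n => w ^ bigOmega n * H ((n * θ + s : ℝ) : UnitAddCircle) := by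
  have hf : ∀ n, ‖w ^ bigOmega n‖ ≤ 1 := fun n => by
    rw [norm_pow]
    exact pow_le_one₀ (norm_nonneg _) hw
  have h := meanZero_mul_comp_sub_integral hf (c := 0)
    (x := fun n => ((n * θ + s : ℝ) : UnitAddCircle)) (fun k => ?_) H
  · simpa using h
  · rcases eq_or_ne k 0 with rfl | hk
    · simpa using meanZero_omega hw hw1
    · simpa using meanZero_omega_mul_fourier hw hθ s hk

/-- Weyl's equidistribution theorem. -/
theorem meanZero_comp_sub_integral (hθ : Irrational θ) (s : ℝ) (H : C(UnitAddCircle, ℂ)) :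
    MeanZero fun n => H ((n * θ + s : ℝ) : UnitAddCircle) -
      ∫ t : UnitAddCircle, H t ∂haarAddCircle := by
  have h := meanZero_mul_comp_sub_integral (f := fun _ => 1) (by simp) (c := 1)
    (x := fun n => ((n * θ + s : ℝ) : UnitAddCircle)) (fun k => ?_) H
  · simpa using h
  · rcases eq_or_ne k 0 with rfl | hk
    · simp [MeanZero]
    · simp only [integral_fourier hk, mul_zero, sub_zero]
      simpa only [one_pow] using meanZero_omega_mul_fourier (w := 1) (by simp) hθ s hk

theorem liftIco_coe_eq_fract (f : ℝ → ℂ) (t : ℝ) :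
    liftIco 1 0 f (t : UnitAddCircle) = f (Int.fract t) := by
  have h : (t : UnitAddCircle) = (Int.fract t : ℝ) := by
    rw [← sub_eq_zero, ← AddCircle.coe_sub, Int.self_sub_fract, AddCircle.coe_eq_zero_iff]
    exact ⟨⌊t⌋, by simp⟩
  rw [h, liftIco_coe_apply]
  exact ⟨Int.fract_nonneg t, by simpa using Int.fract_lt_one t⟩

theorem exists_continuousMap_eq_fract {f : ℝ → ℂ} (hf : Continuous f) (h01 : f 0 = f 1) :
    ∃ H : C(UnitAddCircle, ℂ), (∀ t : ℝ, H t = f (Int.fract t)) ∧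
      ∫ t : UnitAddCircle, H t ∂haarAddCircle = ∫ t in (0 : ℝ)..1, f t := by
  refine ⟨⟨liftIco 1 0 f, liftIco_zero_continuous h01 hf.continuousOn⟩, liftIco_coe_eq_fract f, ?_⟩
  rw [integral_haarAddCircle, inv_one, one_smul, ← UnitAddCircle.intervalIntegral_preimage 0,
    zero_add]
  simp only [ContinuousMap.coe_mk]
  refine intervalIntegral.integral_congr_ae ?_
  have h1 : ∀ᵐ t : ℝ, t ≠ 1 := by simp [ae_iff]
  filter_upwards [h1] with t ht ht'
  rw [Set.uIoc_of_le zero_le_one] at ht'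
  rw [liftIco_coe_eq_fract, Int.fract_eq_self.2 ⟨ht'.1.le, lt_of_le_of_ne ht'.2 ht⟩]

theorem meanZero_omega_mul_fract (hw : ‖w‖ ≤ 1) (hw1 : w.re < 1) (hθ : Irrational θ) (s : ℝ) :
    MeanZero fun n => w ^ bigOmega n * (Int.fract (n * θ + s) : ℝ) := by
  refine meanZero_of_approx fun ε hε => ?_
  obtain ⟨j, hj⟩ := exists_nat_gt (4 / ε)
  have hj0 : 0 < j := by
    have : (0 : ℝ) < j := lt_trans (by positivity) hj
    exact_mod_cast this
  obtain ⟨V, hV, -⟩ := exists_continuousMap_eq_fract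
    (f := fun y : ℝ => ((y + (1 - y) ^ j : ℝ) : ℂ)) (by fun_prop) (by simp [hj0.ne'])
  obtain ⟨U, hU, hU'⟩ := exists_continuousMap_eq_fract
    (f := fun y : ℝ => (((1 - y) ^ j + y ^ j : ℝ) : ℂ)) (by fun_prop) (by simp [hj0.ne'])
  have hUint : ∫ t : UnitAddCircle, U t ∂haarAddCircle = ((2 / (j + 1) : ℝ) : ℂ) := by
    rw [hU', intervalIntegral.integral_ofReal, intervalIntegral.integral_add
      (Continuous.intervalIntegrable (by fun_prop) _ _)
      (Continuous.intervalIntegrable (by fun_prop) _ _),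
      intervalIntegral.integral_comp_sub_left (fun y => y ^ j) 1, sub_self, sub_zero,
      integral_pow, ← two_mul]
    simp
    ring
  refine ⟨_, meanZero_omega_mul_continuous hw hw1 hθ s V, ?_⟩
  have hmean := meanZero_comp_sub_integral hθ s U
  rw [MeanZero, NormedAddGroup.tendsto_nhds_zero] at hmean
  filter_upwards [hmean (ε / 2) (by positivity), eventually_gt_atTop 0] with N hN hN0
  have hN' : (0 : ℝ) < N := by exact_mod_cast hN0
  rw [norm_div, Complex.norm_natCast, div_lt_iff₀ hN', Finset.sum_sub_distrib, hUint] at hN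
  have hterm : ∀ n ∈ Finset.Icc 1 N, ‖w ^ bigOmega n * (Int.fract (n * θ + s) : ℝ) -
      w ^ bigOmega n * V ((n * θ + s : ℝ) : UnitAddCircle)‖ ≤
      (1 - Int.fract (n * θ + s)) ^ j + Int.fract (n * θ + s) ^ j := by
    intro n _
    have h0 := Int.fract_nonneg (n * θ + s)
    have h1 := (Int.fract_lt_one (n * θ + s)).le
    rw [← mul_sub, norm_mul, norm_pow, hV, ← Complex.ofReal_sub, Complex.norm_real,
      Real.norm_eq_abs, sub_add_cancel_left, abs_neg, abs_of_nonneg (pow_nonneg (by linarith) _)]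
    refine (mul_le_of_le_one_left (pow_nonneg (by linarith) _)
      (pow_le_one₀ (norm_nonneg _) hw)).trans (le_add_of_nonneg_right (pow_nonneg h0 _))
  refine (norm_sum_le_of_le _ hterm).trans ?_
  have hUsum : ∑ n ∈ Finset.Icc 1 N, U ((n * θ + s : ℝ) : UnitAddCircle) =
      ((∑ n ∈ Finset.Icc 1 N, ((1 - Int.fract (n * θ + s)) ^ j + Int.fract (n * θ + s) ^ j) : ℝ)
        : ℂ) := by
    rw [Complex.ofReal_sum]
    exact Finset.sum_congr rfl fun n _ => hU _
  rw [hUsum, Finset.sum_const, Nat.card_Icc, nsmul_eq_mul, Nat.add_sub_cancel,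
    ← Complex.ofReal_natCast, ← Complex.ofReal_mul, ← Complex.ofReal_sub, Complex.norm_real,
    Real.norm_eq_abs] at hN
  have h2 := (abs_lt.1 hN).2
  have h3 : (2 / (j + 1) : ℝ) ≤ ε / 2 := by
    rw [div_lt_iff₀ hε] at hj
    rw [div_le_iff₀ (by positivity)]
    nlinarith
  have h4 := mul_le_mul_of_nonneg_left h3 hN'.le
  linarith

end Circle

section Beatty
variable {α β : ℝ} {w : ℂ}

theorem ceil_mul_inv_le_iff (hα : 0 < α) (m n : ℤ) :
    ⌈(m - β) * α⁻¹⌉ ≤ n ↔ m ≤ ⌊α * n + β⌋ := by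
  rw [Int.ceil_le, Int.le_floor, ← div_eq_mul_inv, div_le_iff₀ hα, sub_le_iff_le_add,
    mul_comm α]

/-- The weight is the number of integers `n` with `⌊α * n + β⌋ = m`. -/
theorem meanZero_omega_mul_ceil_sub_ceil (hα : 0 < α) (hw : ‖w‖ ≤ 1) (hw1 : w.re < 1) :
    MeanZero fun m => w ^ bigOmega m *
      ((⌈((m : ℤ) + 1 - β) * α⁻¹⌉ - ⌈((m : ℤ) - β) * α⁻¹⌉ : ℤ) : ℂ) := by
  have h0 : α⁻¹ ≠ 0 := (inv_pos.2 hα).ne'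
  generalize α⁻¹ = θ at *
  by_cases hirr : Irrational θ
  · have hceil : ∀ x : ℝ, (⌈x⌉ : ℝ) = x + Int.fract (-x) := fun x => by
      rw [← Int.self_sub_floor, Int.floor_neg]
      push_cast
      ring
    have h1 := meanZero_omega_mul_fract hw hw1 hirr.neg ((β - 1) * θ)
    have h2 := meanZero_omega_mul_fract hw hw1 hirr.neg (β * θ)
    convert (((meanZero_omega_mul_periodic hw hw1 one_pos (c := fun _ => (θ : ℂ))
      fun _ => rfl).add h1).sub h2) using 2 with m
    rw [← Complex.ofReal_intCast, Int.cast_sub, hceil, hceil, ← mul_add, ← mul_sub]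
    congr 1
    rw [← Complex.ofReal_add, ← Complex.ofReal_sub]
    congr 1
    rw [show -(((m : ℤ) + 1 - β) * θ) = m * -θ + (β - 1) * θ by push_cast; ring,
      show -(((m : ℤ) - β) * θ) = m * -θ + β * θ by push_cast; ring]
    push_cast
    ring
  · obtain ⟨ρ, rfl⟩ : ∃ ρ : ℚ, (ρ : ℝ) = θ := by simpa [Irrational] using hirr
    refine meanZero_omega_mul_periodic hw hw1 ρ.den_pos fun m => ?_
    have hshift : ∀ x : ℝ, ⌈(x + ρ.den) * ρ⌉ = ⌈x * ρ⌉ + ρ.num := fun x => by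
      rw [← Int.ceil_add_intCast]
      congr 1
      have : (ρ.den : ℝ) * ρ = ρ.num := by exact_mod_cast Rat.den_mul_eq_num ρ
      linear_combination this
    have e1 : ((((m + ρ.den : ℕ) : ℤ) : ℝ) + 1 - β) = ((m : ℤ) + 1 - β) + ρ.den := by
      push_cast; ring
    have e2 : ((((m + ρ.den : ℕ) : ℤ) : ℝ) - β) = ((m : ℤ) - β) + ρ.den := by
      push_cast; ring
    simp only [e1, e2, hshift]
    congr 1
    ring

theorem sum_mul_ceil_sub_ceil (hα : 0 < α) (a : ℕ → ℂ) (M : ℕ) :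
    ∑ m ∈ Finset.Icc 1 M,
      a m * ((⌈((m : ℤ) + 1 - β) * α⁻¹⌉ - ⌈((m : ℤ) - β) * α⁻¹⌉ : ℤ) : ℂ) =
    ∑ n ∈ Finset.Ico ⌈((1 : ℤ) - β) * α⁻¹⌉ ⌈((M + 1 : ℤ) - β) * α⁻¹⌉, a ⌊α * n + β⌋.toNat := by
  have hmono : ∀ x y : ℝ, x ≤ y → ⌈(x - β) * α⁻¹⌉ ≤ ⌈(y - β) * α⁻¹⌉ := fun x y h => by
    have := (inv_pos.2 hα).le
    gcongr
  induction M with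
  | zero => simp
  | succ M ih =>
    rw [Finset.sum_Icc_succ_top (by omega), ih]
    have hu := Finset.Ico_union_Ico_eq_Ico
      (hmono (1 : ℤ) (M + 1 : ℤ) (by exact_mod_cast (by omega : (1 : ℤ) ≤ M + 1)))
      (hmono (M + 1 : ℤ) ((M + 1 : ℕ) + 1 : ℤ) (by push_cast; linarith))
    push_cast at hu ⊢
    rw [← hu, Finset.sum_union (Finset.Ico_disjoint_Ico_consecutive _ _ _)]
    congr 1
    have hconst : ∀ n ∈ Finset.Ico ⌈((M : ℝ) + 1 - β) * α⁻¹⌉ ⌈((M : ℝ) + 1 + 1 - β) * α⁻¹⌉,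
        a ⌊α * n + β⌋.toNat = a (M + 1) := by
      intro n hn
      rw [Finset.mem_Ico] at hn
      have h1 := (ceil_mul_inv_le_iff (β := β) hα (M + 1) n).1 (by push_cast; exact hn.1)
      have h2 := (ceil_mul_inv_le_iff (β := β) hα (M + 1 + 1) n).not.1
        (by push_cast; exact not_le.2 hn.2)
      congr 1
      omega
    rw [Finset.sum_congr rfl hconst, Finset.sum_const, Int.card_Ico, nsmul_eq_mul, mul_comm,
      ← Int.cast_natCast (Int.toNat _), Int.toNat_of_nonneg]
    · push_cast
      rfl
    · have := hmono (M + 1 : ℝ) (M + 1 + 1) (by linarith)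
      omega

theorem norm_sum_floor_sub_le (hα : 0 < α) (hαβ : 1 ≤ α + β) {a : ℕ → ℂ} (ha : ∀ n, ‖a n‖ ≤ 1)
    {N : ℕ} (hN : 0 < N) :
    ‖(∑ m ∈ Finset.Icc 1 ⌊α * N + β⌋.toNat,
        a m * ((⌈((m : ℤ) + 1 - β) * α⁻¹⌉ - ⌈((m : ℤ) - β) * α⁻¹⌉ : ℤ) : ℂ)) -
      ∑ n ∈ Finset.Icc 1 N, a ⌊α * n + β⌋.toNat‖ ≤ α⁻¹ + 1 - ⌈((1 : ℤ) - β) * α⁻¹⌉ := by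
  have hN1 : (1 : ℝ) ≤ N := by exact_mod_cast hN
  have hfloor : 1 ≤ ⌊α * N + β⌋ := by
    rw [Int.le_floor]
    push_cast
    nlinarith
  rw [sum_mul_ceil_sub_ceil hα, Int.toNat_of_nonneg (by omega)]
  have hIcc : ∑ n ∈ Finset.Icc 1 N, a ⌊α * n + β⌋.toNat =
      ∑ n ∈ Finset.Ico (1 : ℤ) (N + 1), a ⌊α * n + β⌋.toNat := by
    refine Finset.sum_nbij' (fun n => (n : ℤ)) Int.toNat ?_ ?_ ?_ ?_ ?_
    · intro n hn
      simp only [Finset.mem_Icc, Finset.mem_Ico] at hn ⊢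
      omega
    · intro n hn
      simp only [Finset.mem_Icc, Finset.mem_Ico] at hn ⊢
      omega
    · intro n hn
      simp
    · intro n hn
      simp only [Finset.mem_Ico] at hn
      omega
    · intro n hn
      simp
  have hlow : ⌈((1 : ℤ) - β) * α⁻¹⌉ ≤ 1 := by
    rw [ceil_mul_inv_le_iff hα, Int.le_floor]
    push_cast
    linarith
  have hhigh : (N + 1 : ℤ) ≤ ⌈((⌊α * N + β⌋ + 1 : ℤ) - β) * α⁻¹⌉ := by
    have := (ceil_mul_inv_le_iff (β := β) hα (⌊α * N + β⌋ + 1) N).not.2 (by push_cast; omega)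
    omega
  have hupper : (⌈((⌊α * N + β⌋ + 1 : ℤ) - β) * α⁻¹⌉ : ℝ) ≤ N + α⁻¹ + 1 := by
    have h1 := (Int.ceil_lt_add_one (((⌊α * N + β⌋ + 1 : ℤ) - β) * α⁻¹)).le
    have h2 : (((⌊α * N + β⌋ + 1 : ℤ) - β) * α⁻¹) ≤ (α * N + 1) * α⁻¹ := by
      have := Int.floor_le (α * N + β)
      have := (inv_pos.2 hα).le
      gcongr
      push_cast
      linarith
    have h3 : (α * N + 1) * α⁻¹ = N + α⁻¹ := by
      field_simp
    push_cast at h1 h2 ⊢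
    linarith
  have hsub : Finset.Ico (1 : ℤ) (N + 1) ⊆
      Finset.Ico ⌈((1 : ℤ) - β) * α⁻¹⌉ ⌈((⌊α * N + β⌋ + 1 : ℤ) - β) * α⁻¹⌉ :=
    Finset.Ico_subset_Ico hlow hhigh
  rw [hIcc]
  push_cast at hsub hlow hhigh hupper ⊢
  rw [← Finset.sum_sdiff hsub, add_sub_cancel_right]
  refine (norm_sum_le_of_le _ fun n _ => ha _).trans ?_
  rw [Finset.sum_const, nsmul_eq_mul, mul_one, Finset.card_sdiff_of_subset hsub, Int.card_Ico,
    Int.card_Ico, ← Int.cast_natCast]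
  rw [Nat.cast_sub (by omega), Int.toNat_of_nonneg (by omega), Int.toNat_of_nonneg (by omega)]
  push_cast
  linarith

theorem tendsto_floor_toNat (hα : 0 < α) (β : ℝ) :
    Tendsto (fun N : ℕ => ⌊α * N + β⌋.toNat) atTop atTop := by
  refine tendsto_atTop.2 fun b => ?_
  have h : Tendsto (fun N : ℕ => α * (N : ℝ) + β) atTop atTop :=
    (tendsto_natCast_atTop_atTop.const_mul_atTop hα).atTop_add tendsto_const_nhds
  filter_upwards [h.eventually_ge_atTop (b : ℝ)] with N hN
  have : (b : ℤ) ≤ ⌊α * N + β⌋ := by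
    rw [Int.le_floor]
    exact_mod_cast hN
  omega

theorem meanZero_omega_floor (hα : 0 < α) (hαβ : 1 ≤ α + β) (hw : ‖w‖ ≤ 1) (hw1 : w.re < 1) :
    MeanZero fun n => w ^ bigOmega ⌊α * n + β⌋.toNat := by
  have h1 := (meanZero_omega_mul_ceil_sub_ceil (β := β) hα hw hw1).tendsto_comp
    (tendsto_floor_toNat hα β) (C := α + |β|) ?_
  · have ha : ∀ n, ‖w ^ bigOmega n‖ ≤ 1 := fun n => by
      rw [norm_pow]
      exact pow_le_one₀ (norm_nonneg _) hw
    have h2 : Tendsto (fun N : ℕ => ((∑ m ∈ Finset.Icc 1 ⌊α * N + β⌋.toNat, w ^ bigOmega m *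
        ((⌈((m : ℤ) + 1 - β) * α⁻¹⌉ - ⌈((m : ℤ) - β) * α⁻¹⌉ : ℤ) : ℂ)) -
        ∑ n ∈ Finset.Icc 1 N, w ^ bigOmega ⌊α * n + β⌋.toNat) / (N : ℂ)) atTop (𝓝 0) := by
      refine squeeze_zero_norm' (a := fun N : ℕ =>
        (α⁻¹ + 1 - ⌈((1 : ℤ) - β) * α⁻¹⌉) / (N : ℝ)) ?_
        (tendsto_const_div_atTop_nhds_zero_nat _)
      filter_upwards [eventually_gt_atTop 0] with N hN
      rw [norm_div, Complex.norm_natCast]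
      gcongr
      exact norm_sum_floor_sub_le hα hαβ ha hN
    have h3 := h1.sub h2
    rw [sub_zero] at h3
    refine h3.congr fun N => ?_
    rw [← sub_div, sub_sub_cancel]
  · filter_upwards [eventually_gt_atTop 0] with N hN
    have hN1 : (1 : ℝ) ≤ N := by exact_mod_cast hN
    have h4 : α * N + β ≤ (α + |β|) * N := by
      nlinarith [le_abs_self β, abs_nonneg β]
    have h5 : (⌊α * N + β⌋ : ℝ) ≤ α * N + β := Int.floor_le _
    have h6 : (⌊α * N + β⌋.toNat : ℤ) = max ⌊α * N + β⌋ 0 := Int.toNat_eq_max _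
    have h7 : (⌊α * N + β⌋.toNat : ℝ) = max (⌊α * N + β⌋ : ℝ) 0 := by exact_mod_cast h6
    rw [h7]
    exact max_le (h5.trans h4) (by positivity)

end Beatty

theorem re_lt_one_of_norm_eq_one {z : ℂ} (h : ‖z‖ = 1) (h1 : z ≠ 1) : z.re < 1 := by
  refine lt_of_le_of_ne (h ▸ Complex.re_le_norm z) fun hre => h1 ?_
  have h2 : z.re * z.re + z.im * z.im = 1 := by
    rw [← Complex.normSq_apply, Complex.normSq_eq_norm_sq, h, one_pow]
  refine Complex.ext hre ?_
  rw [hre] at h2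
  simpa using h2

theorem sum_zpow_pow_eq_ite {ζ : ℂ} {k : ℕ} (hζ : IsPrimitiveRoot ζ k) (m : ℤ) :
    ∑ j ∈ Finset.range k, (ζ ^ m) ^ j = if (k : ℤ) ∣ m then (k : ℂ) else 0 := by
  split_ifs with h
  · rw [(hζ.zpow_eq_one_iff_dvd m).2 h]
    simp
  · rw [geom_sum_eq fun h1 => h ((hζ.zpow_eq_one_iff_dvd m).1 h1), ← zpow_natCast, ← zpow_mul,
      mul_comm, zpow_mul, zpow_natCast, hζ.pow_eq_one]
    simp

theorem stmt6 (α β : ℝ) (hα : 0 < α) (hαβ : 1 ≤ α + β) (k r : ℕ) (hk : 0 < k) (hr : r < k) :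
    Tendsto
      (fun N : ℕ =>
        (((Finset.Icc 1 N).filter
            (fun n : ℕ => (k : ℤ) ∣ ((bigOmega (⌊α * (n : ℝ) + β⌋).toNat : ℤ) - r))).card : ℝ) / N)
      atTop (nhds (1 / k)) := by
  have hζ := Complex.isPrimitiveRoot_exp k hk.ne'
  set ζ := Complex.exp (2 * Real.pi * Complex.I / k)
  have hζ0 : ζ ≠ 0 := hζ.ne_zero hk.ne'
  have hk0 : (k : ℂ) ≠ 0 := by exact_mod_cast hk.ne'
  have hζn : ‖ζ‖ = 1 := hζ.norm'_eq_one hk.ne'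
  have hmean := MeanZero.sum (s := (Finset.range k).erase 0) fun j hj => by
    rw [Finset.mem_erase, Finset.mem_range] at hj
    have hn : ‖ζ ^ j‖ = 1 := by rw [norm_pow, hζn, one_pow]
    exact (meanZero_omega_floor hα hαβ hn.le (re_lt_one_of_norm_eq_one hn
      (hζ.pow_ne_one_of_pos_of_lt hj.1 hj.2))).const_mul ((k : ℂ)⁻¹ * ((ζ ^ r) ^ j)⁻¹)
  have hind : ∀ n : ℕ, ∑ j ∈ (Finset.range k).erase 0, (k : ℂ)⁻¹ * ((ζ ^ r) ^ j)⁻¹ *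
      (ζ ^ j) ^ bigOmega ⌊α * n + β⌋.toNat =
      (if (k : ℤ) ∣ ((bigOmega (⌊α * (n : ℝ) + β⌋).toNat : ℤ) - r) then 1 else 0) -
        (k : ℂ)⁻¹ := by
    intro n
    have h1 := sum_zpow_pow_eq_ite hζ ((bigOmega (⌊α * (n : ℝ) + β⌋).toNat : ℤ) - r)
    rw [← Finset.add_sum_erase _ _ (Finset.mem_range.2 hk), pow_zero] at h1
    have h2 : ∀ j, (k : ℂ)⁻¹ * ((ζ ^ r) ^ j)⁻¹ * (ζ ^ j) ^ bigOmega ⌊α * n + β⌋.toNat =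
        (k : ℂ)⁻¹ * (ζ ^ ((bigOmega (⌊α * (n : ℝ) + β⌋).toNat : ℤ) - r)) ^ j := fun j => by
      rw [zpow_sub₀ hζ0, zpow_natCast, zpow_natCast, div_pow, ← pow_mul ζ j, mul_comm j, pow_mul,
        mul_assoc, div_eq_inv_mul]
    simp only [h2]
    rw [← Finset.mul_sum, eq_sub_of_add_eq' h1, mul_sub, mul_one, mul_ite, mul_zero,
      inv_mul_cancel₀ hk0]
  simp only [hind] at hmean
  have h3 : Tendsto (fun N : ℕ => (((((Finset.Icc 1 N).filter (fun n : ℕ =>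
      (k : ℤ) ∣ ((bigOmega (⌊α * (n : ℝ) + β⌋).toNat : ℤ) - r))).card : ℝ) / N : ℝ) : ℂ))
      atTop (𝓝 ((1 / k : ℝ) : ℂ)) := by
    have h4 := hmean.add_const (k : ℂ)⁻¹
    rw [zero_add] at h4
    convert h4.congr' ?_ using 2
    · simp
    filter_upwards [eventually_gt_atTop 0] with N hN
    have hN0 : (N : ℂ) ≠ 0 := by exact_mod_cast hN.ne'
    rw [Finset.sum_sub_distrib, Finset.sum_boole, Finset.sum_const, Nat.card_Icc, nsmul_eq_mul,
      Nat.add_sub_cancel, sub_div, mul_div_cancel_left₀ _ hN0, sub_add_cancel]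
    push_cast
    rfl
  exact_mod_cast (Complex.continuous_re.tendsto _).comp h3
end

section
/- Define T_β : 𝕋^k → 𝕋^k by T_β(x₁,…,x_k) = (x₁+β, x₂+x₁, …, x_k+x_{k−1}). If β is irrational, then (𝕋^k, T_β) is uniquely ergodic and its unique invariant Borel probability measure is the k-fold product of Haar measure on 𝕋. -/
open MeasureTheory Filter Topology

/-- The unipotent affine (skew product) map
`T_β(x₁,…,x_k) = (x₁+β, x₂+x₁, …, x_k+x_{k−1})` on the `k`-torus. -/
noncomputable def skewT (k : ℕ) (β : ℝ) :
    (Fin k → AddCircle (1 : ℝ)) → (Fin k → AddCircle (1 : ℝ)) :=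
  fun x i =>
    if i.1 = 0 then x i + (β : AddCircle (1 : ℝ))
    else x i + x ⟨i.1 - 1, lt_of_le_of_lt (Nat.sub_le _ _) i.2⟩
namespace SkewProduct

open UnitAddTorus ComplexConjugate

lemma continuous_skewT (k : ℕ) (β : ℝ) : Continuous (skewT k β) := by
  refine continuous_pi fun i => ?_
  unfold skewT
  split_ifs <;> fun_prop

/-- The linear action on frequencies dual to the linear part of the skew product. -/
def shift {k : ℕ} (n : Fin (k + 1) → ℤ) : Fin (k + 1) → ℤ :=
  n + (Fin.snoc (fun i : Fin k => n i.succ) 0 : Fin (k + 1) → ℤ)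

lemma shift_castSucc {k : ℕ} (n : Fin (k + 1) → ℤ) (i : Fin k) :
    shift n i.castSucc = n i.castSucc + n i.succ := by
  simp [shift]

lemma shift_last {k : ℕ} (n : Fin (k + 1) → ℤ) : shift n (Fin.last k) = n (Fin.last k) := by
  simp [shift]

lemma shift_apply_of_le {k : ℕ} {n : Fin (k + 1) → ℤ} {j : Fin (k + 1)}
    (hn : ∀ i, j < i → n i = 0) {i : Fin (k + 1)} (hi : j ≤ i) : shift n i = n i := by
  induction i using Fin.lastCases with
  | last => exact shift_last n
  | cast l => rw [shift_castSucc, hn _ (hi.trans_lt l.castSucc_lt_succ), add_zero]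

lemma iterate_shift_apply_of_le {k : ℕ} {n : Fin (k + 1) → ℤ} {j : Fin (k + 1)}
    (hn : ∀ i, j < i → n i = 0) (m : ℕ) :
    ∀ i, j ≤ i → shift^[m] n i = n i := by
  induction m with
  | zero => simp
  | succ m ih =>
    intro i hi
    rw [Function.iterate_succ_apply',
      shift_apply_of_le (fun l hl => (ih l hl.le).trans (hn l hl)) hi, ih i hi]

lemma iterate_shift_castSucc {k : ℕ} {n : Fin (k + 1) → ℤ} {j : Fin k}
    (hn : ∀ i, j.succ < i → n i = 0) (m : ℕ) :
    shift^[m] n j.castSucc = n j.castSucc + m * n j.succ := by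
  induction m with
  | zero => simp
  | succ m ih =>
    rw [Function.iterate_succ_apply', shift_castSucc, ih,
      iterate_shift_apply_of_le hn m _ le_rfl]
    push_cast
    ring

lemma exists_last_ne_zero {k : ℕ} {n : Fin k → ℤ} (hn : n ≠ 0) :
    ∃ j, n j ≠ 0 ∧ ∀ i, j < i → n i = 0 := by
  obtain ⟨i, hi⟩ := Function.ne_iff.1 hn
  obtain ⟨j, hj, hmax⟩ := (Finset.univ.filter fun i => n i ≠ 0).exists_max_image id
    ⟨i, by simpa using hi⟩
  refine ⟨j, by simpa using hj, fun l hl => ?_⟩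
  by_contra h
  exact absurd (hmax l (by simpa using h)) (not_le.2 hl)

lemma shift_ne_zero {k : ℕ} {n : Fin (k + 1) → ℤ} (hn : n ≠ 0) : shift n ≠ 0 := by
  obtain ⟨j, hj, hlast⟩ := exists_last_ne_zero hn
  intro h
  exact hj (by rw [← shift_apply_of_le hlast le_rfl, h, Pi.zero_apply])

lemma norm_fourier_apply (n : ℤ) (x : AddCircle (1 : ℝ)) : ‖fourier n x‖ = 1 := by
  rw [fourier_apply, Circle.norm_coe]

lemma norm_mFourier_apply {d : Type*} [Fintype d] (n : d → ℤ) (x : UnitAddTorus d) :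
    ‖mFourier n x‖ = 1 := by
  simp only [mFourier, ContinuousMap.coe_mk, norm_prod, norm_fourier_apply, Finset.prod_const_one]

lemma fourier_add_apply (n : ℤ) (x y : AddCircle (1 : ℝ)) :
    fourier n (x + y) = fourier n x * fourier n y := by
  simp [fourier_apply, AddCircle.toCircle_add]

lemma mFourier_skewT {k : ℕ} (β : ℝ) (n : Fin (k + 1) → ℤ) (x : UnitAddTorus (Fin (k + 1))) :
    mFourier n (skewT (k + 1) β x) =
      fourier (n 0) (β : AddCircle (1 : ℝ)) * mFourier (shift n) x := by
  have h0 : skewT (k + 1) β x 0 = x 0 + (β : AddCircle (1 : ℝ)) := by simp [skewT]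
  have hs (i : Fin k) : skewT (k + 1) β x i.succ = x i.succ + x i.castSucc := by
    simp [skewT, Fin.castSucc, Fin.castAdd, Fin.castLE]
  have hl : mFourier (Fin.snoc (fun i : Fin k => n i.succ) 0 : Fin (k + 1) → ℤ) x =
      ∏ i : Fin k, fourier (n i.succ) (x i.castSucc) := by
    simp [mFourier, Fin.prod_univ_castSucc]
  rw [shift, mFourier_add, hl]
  simp only [mFourier, ContinuousMap.coe_mk, Fin.prod_univ_succ, h0, hs, fourier_add_apply,
    Finset.prod_mul_distrib]
  ring

lemma exists_mFourier_iterate_skewT {k : ℕ} (β : ℝ) (n : Fin (k + 1) → ℤ) (m : ℕ) :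
    ∃ c : ℂ, ∀ x, mFourier n ((skewT (k + 1) β)^[m] x) = c * mFourier (shift^[m] n) x := by
  induction m with
  | zero => exact ⟨1, by simp⟩
  | succ m ih =>
    obtain ⟨c, hc⟩ := ih
    refine ⟨c * fourier (shift^[m] n 0) (β : AddCircle (1 : ℝ)), fun x => ?_⟩
    rw [Function.iterate_succ_apply, hc, mFourier_skewT, Function.iterate_succ_apply', mul_assoc]

lemma fourier_ne_one {β : ℝ} (hβ : Irrational β) {n : ℤ} (hn : n ≠ 0) :
    fourier n (β : AddCircle (1 : ℝ)) ≠ 1 := by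
  rw [fourier_coe_apply, Ne, Complex.exp_eq_one_iff]
  rintro ⟨m, hm⟩
  have h : (n : ℂ) * β = m := by
    have := Complex.two_pi_I_ne_zero
    apply mul_left_cancel₀ this
    rw [mul_comm _ (m : ℂ), ← hm]
    push_cast
    ring
  exact (hβ.intCast_mul hn).ne_int m (by exact_mod_cast h)

/-- Two finite measures on a torus with the same Fourier coefficients coincide. -/
lemma measure_ext_of_integral_mFourier {d : Type*} [Fintype d]
    {μ ν : Measure (d → AddCircle (1 : ℝ))} [IsFiniteMeasure μ] [IsFiniteMeasure ν]
    (h : ∀ n : d → ℤ, ∫ x, mFourier n x ∂μ = ∫ x, mFourier n x ∂ν) : μ = ν := by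
  let e := BoundedContinuousFunction.toContinuousMapStarₐ ℂ
    (α := d → AddCircle (1 : ℝ)) (β := ℂ)
  refine ext_of_forall_mem_subalgebra_integral_eq_of_polish (𝕜 := ℂ)
    (A := (mFourierSubalgebra d).comap e) ?_ ?_
  · intro x y hxy
    obtain ⟨_, ⟨f, hf, rfl⟩, hne⟩ := mFourierSubalgebra_separatesPoints hxy
    exact ⟨f, ⟨f, ⟨BoundedContinuousFunction.mkOfCompact f, hf, rfl⟩, rfl⟩, hne⟩
  · intro g hg
    have hspan : e g ∈ Submodule.span ℂ (Set.range (mFourier (d := d))) := by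
      rw [← mFourierSubalgebra_coe]
      exact hg
    have hint (f : C(d → AddCircle (1 : ℝ), ℂ)) (ρ : Measure (d → AddCircle (1 : ℝ)))
        [IsFiniteMeasure ρ] : Integrable f ρ :=
      f.continuous.integrable_of_hasCompactSupport (HasCompactSupport.of_compactSpace f)
    have key : ∀ f ∈ Submodule.span ℂ (Set.range (mFourier (d := d))),
        ∫ x, f x ∂μ = ∫ x, f x ∂ν := by
      intro f hf
      induction hf using Submodule.span_induction with
      | mem f hf =>
        obtain ⟨n, rfl⟩ := hf
        exact h n
      | zero => simp
      | add f g _ _ hf hg =>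
        simp only [ContinuousMap.add_apply]
        rw [integral_add (hint f μ) (hint g μ), integral_add (hint f ν) (hint g ν), hf, hg]
      | smul c f _ hf =>
        simp only [ContinuousMap.smul_apply, integral_smul, hf]
    exact key _ hspan

lemma integral_fourier_volume {n : ℤ} (hn : n ≠ 0) :
    ∫ x : AddCircle (1 : ℝ), fourier n x = 0 := by
  have h := integral_add_right_eq_self (μ := (volume : Measure (AddCircle (1 : ℝ))))
    (fun x => (fourier n x : ℂ)) ((1 / 2 / n : ℝ) : AddCircle (1 : ℝ))
  simp only [fourier_add_half_inv_index hn one_pos, integral_neg] at h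
  exact self_eq_neg.1 h.symm

lemma integral_mFourier_volume {d : Type*} [Fintype d] {n : d → ℤ} (hn : n ≠ 0) :
    ∫ x : d → AddCircle (1 : ℝ), mFourier n x = 0 := by
  obtain ⟨i, hi⟩ := Function.ne_iff.1 hn
  have h := integral_fintype_prod_volume_eq_prod
    (fun i (x : AddCircle (1 : ℝ)) => (fourier (n i) x : ℂ))
  exact h.trans (Finset.prod_eq_zero (Finset.mem_univ i) (integral_fourier_volume hi))

lemma integral_comp_eq_of_map_eq {X : Type*} [TopologicalSpace X] [MeasurableSpace X]
    [BorelSpace X] {T : X → X} (hT : Continuous T) {ν : Measure X} (hν : ν.map T = ν)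
    (f : C(X, ℂ)) [SecondCountableTopology X] : ∫ x, f (T x) ∂ν = ∫ x, f x ∂ν := by
  conv_rhs => rw [← hν]
  exact (integral_map hT.aemeasurable f.continuous.aestronglyMeasurable).symm

lemma map_skewT_volume (k : ℕ) (β : ℝ) :
    Measure.map (skewT (k + 1) β) (volume : Measure (Fin (k + 1) → AddCircle (1 : ℝ))) =
      volume := by
  refine measure_ext_of_integral_mFourier fun n => ?_
  rw [integral_map (continuous_skewT _ β).aemeasurable
    (mFourier n).continuous.aestronglyMeasurable]
  simp_rw [mFourier_skewT]
  rw [integral_const_mul]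
  rcases eq_or_ne n 0 with rfl | hn
  · have : shift (0 : Fin (k + 1) → ℤ) = 0 := by
      ext i
      exact shift_apply_of_le (j := 0) (fun _ _ => rfl) (Fin.zero_le i)
    simp [this]
  · rw [integral_mFourier_volume hn, integral_mFourier_volume (shift_ne_zero hn), mul_zero]

/-- If the translates of a continuous unimodular function along the orbits of a measure-preserving
map are pairwise orthogonal, then Bessel's inequality forces its mean to vanish. -/
lemma integral_eq_zero_of_orthogonal_iterates {X : Type*} [TopologicalSpace X] [CompactSpace X]
    [MeasurableSpace X] [BorelSpace X] [SecondCountableTopology X] {T : X → X}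
    (hT : Continuous T) {ν : Measure X} [IsProbabilityMeasure ν] (hν : ν.map T = ν) (f : C(X, ℂ))
    (hf : ∀ x, ‖f x‖ = 1)
    (horth : ∀ m l : ℕ, m ≠ l → ∫ x, f (T^[l] x) * conj (f (T^[m] x)) ∂ν = 0) :
    ∫ x, f x ∂ν = 0 := by
  let F : ℕ → C(X, ℂ) := fun m => f.comp ⟨T^[m], hT.iterate m⟩
  let v : ℕ → Lp ℂ 2 ν := fun m => ContinuousMap.toLp 2 ν ℂ (F m)
  have hv : Orthonormal ℂ v := by
    rw [orthonormal_iff_ite]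
    intro m l
    rw [ContinuousMap.inner_toLp]
    split_ifs with h
    · subst h
      simp [F, Complex.mul_conj, Complex.normSq_eq_norm_sq, hf]
    · exact horth m l h
  have hinner (m : ℕ) : inner ℂ (ContinuousMap.toLp 2 ν ℂ 1) (v m) = ∫ x, f x ∂ν := by
    rw [ContinuousMap.inner_toLp]
    have hm : ν.map T^[m] = ν := ((⟨hT.measurable, hν⟩ : MeasurePreserving T ν ν).iterate m).map_eq
    simpa [F] using integral_comp_eq_of_map_eq (hT.iterate m) hm f
  have hs := hv.inner_products_summable (ContinuousMap.toLp 2 ν ℂ 1)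
  have hconst (m : ℕ) : ‖inner ℂ (v m) (ContinuousMap.toLp 2 ν ℂ 1)‖ ^ 2 =
      ‖∫ x, f x ∂ν‖ ^ 2 := by
    rw [norm_inner_symm, hinner]
  rw [summable_congr hconst, summable_const_iff] at hs
  simpa using hs

lemma integral_mFourier_of_map_skewT_eq {k : ℕ} {β : ℝ} (hβ : Irrational β)
    {ν : Measure (Fin (k + 1) → AddCircle (1 : ℝ))} [IsProbabilityMeasure ν]
    (hν : ν.map (skewT (k + 1) β) = ν) (j : Fin (k + 1)) :
    ∀ n : Fin (k + 1) → ℤ, n j ≠ 0 → (∀ i, j < i → n i = 0) →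
      ∫ x, mFourier n x ∂ν = 0 := by
  induction j using Fin.induction with
  | zero =>
    intro n hn hlast
    have hshift : shift n = n := funext fun i => shift_apply_of_le hlast (Fin.zero_le i)
    have h := integral_comp_eq_of_map_eq (continuous_skewT _ β) hν (mFourier n)
    simp_rw [mFourier_skewT, hshift, integral_const_mul] at h
    by_contra h0
    exact fourier_ne_one hβ hn (mul_eq_right₀ h0 |>.1 h)
  | succ j ih =>
    intro n hn hlast
    refine integral_eq_zero_of_orthogonal_iterates (continuous_skewT _ β) hν (mFourier n)
      (norm_mFourier_apply n) fun m l hml => ?_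
    obtain ⟨c, hc⟩ := exists_mFourier_iterate_skewT β n m
    obtain ⟨d, hd⟩ := exists_mFourier_iterate_skewT β n l
    have hprod (x : Fin (k + 1) → AddCircle (1 : ℝ)) :
        mFourier n ((skewT (k + 1) β)^[l] x) * conj (mFourier n ((skewT (k + 1) β)^[m] x)) =
          d * conj c * mFourier (shift^[l] n + -shift^[m] n) x := by
      rw [hc, hd, mFourier_add, mFourier_neg, map_mul]
      ring
    simp_rw [hprod, integral_const_mul]
    rw [ih, mul_zero]
    · rw [Pi.add_apply, Pi.neg_apply, iterate_shift_castSucc hlast, iterate_shift_castSucc hlast]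
      have hlm : ((l : ℤ) - m) * n j.succ ≠ 0 :=
        mul_ne_zero (sub_ne_zero.2 (by exact_mod_cast hml.symm)) hn
      intro h
      exact hlm (by linear_combination h)
    · intro i hi
      have hi' : j.succ ≤ i := Fin.castSucc_lt_iff_succ_le.1 hi
      rw [Pi.add_apply, Pi.neg_apply, iterate_shift_apply_of_le hlast l i hi',
        iterate_shift_apply_of_le hlast m i hi', add_neg_cancel]

end SkewProduct

theorem stmt11 (k : ℕ) (hk : 0 < k) (β : ℝ) (hirr : Irrational β) :
    Measure.map (skewT k β) (volume : Measure (Fin k → AddCircle (1 : ℝ))) = volume ∧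
      ∀ ν : Measure (Fin k → AddCircle (1 : ℝ)), IsProbabilityMeasure ν →
        Measure.map (skewT k β) ν = ν → ν = volume := by
  obtain ⟨k, rfl⟩ := Nat.exists_eq_succ_of_ne_zero hk.ne'
  refine ⟨SkewProduct.map_skewT_volume k β, fun ν _ hν => ?_⟩
  refine SkewProduct.measure_ext_of_integral_mFourier fun n => ?_
  rcases eq_or_ne n 0 with rfl | hn
  · simp [UnitAddTorus.mFourier_zero, measureReal_def, volume_pi, Measure.pi_univ]
  · obtain ⟨j, hj, hlast⟩ := SkewProduct.exists_last_ne_zero hn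
    rw [SkewProduct.integral_mFourier_volume hn,
      SkewProduct.integral_mFourier_of_map_skewT_eq hirr hν j n hj hlast]
end
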